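/- arXiv:1311.7575 — 5 statements merged into one kernel-verified Lean document; each statement's English description precedes it below -/
import Mathlib

section
/- Let X be a pointed metric space and let 0 < q < s < ∞. A sequence (σ_j, x'_j, x''_j)_{j∈ℕ} in ℝ × X × X is Lipschitz mixed (s;q)-summable if and only if for every Borel probability measure μ on B_{X^#} (equipped with the topology of pointwise convergence) one has [Σ_{j=1}^∞ (∫_{B_{X^#}} |σ_j|^s |f(x'_j) − f(x''_j)|^s dμ(f))^{q/s}]^{1/q} < ∞; and in that case sup_{μ ∈ W(B_{X^#})} [Σ_{j=1}^∞ (∫_{B_{X^#}} |σ_j|^s |f(x'_j) − f(x''_j)|^s dμ(f))^{q/s}]^{1/q} = m^L_{(s;q)}(σ, x', x''). -/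
open MeasureTheory ENNReal NNReal

noncomputable section

/-- The closed unit ball `B_{X^#}` of the Lipschitz dual of a pointed metric space `(X, x₀)`:
all Lipschitz functions `f : X → ℝ` with `f x₀ = 0` and Lipschitz constant at most `1`. -/
def dualBall (X : Type*) [MetricSpace X] (x₀ : X) : Set (X → ℝ) :=
  {f | LipschitzWith 1 f ∧ f x₀ = 0}

/-- The strong `ℓ_p` norm `‖(σ,x',x'')|ℓ_p‖ = (Σ_j |σ_j|^p d(x'_j,x''_j)^p)^{1/p}`
(with the sup for `p = ∞`). -/
def strongNorm {X : Type*} [MetricSpace X] (p : ℝ≥0∞) {m : ℕ}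
    (σ : Fin m → ℝ) (x' x'' : Fin m → X) : ℝ≥0∞ :=
  eLpNorm (fun j => σ j * dist (x' j) (x'' j)) p Measure.count

/-- The weak Lipschitz `ℓ_p` norm
`‖(σ,x',x'')|ℓ_p^{L,w}‖ = sup_{f ∈ B_{X^#}} (Σ_j |σ_j|^p |f(x'_j) - f(x''_j)|^p)^{1/p}`. -/
def weakNorm {X : Type*} [MetricSpace X] (x₀ : X) (p : ℝ≥0∞) {m : ℕ}
    (σ : Fin m → ℝ) (x' x'' : Fin m → X) : ℝ≥0∞ :=
  ⨆ f ∈ dualBall X x₀, eLpNorm (fun j => σ j * (f (x' j) - f (x'' j))) p Measure.count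

/-- The `q`-conjugate index `s'(q)`, determined by `1/s'(q) = 1/q - 1/s`. -/
def conjIdx (q s : ℝ≥0∞) : ℝ≥0∞ := (1 / q - 1 / s)⁻¹

/-- The Lipschitz mixed `(s;q)`-norm
`m^L_{(s;q)}(σ,x',x'') = inf ‖τ|ℓ_{s'(q)}‖ ⬝ ‖(σ/τ,x',x'')|ℓ_s^{L,w}‖`,
the infimum over all finite sequences `τ` of nonzero reals. -/
def mixedNorm {X : Type*} [MetricSpace X] (x₀ : X) (s q : ℝ≥0∞) {m : ℕ}
    (σ : Fin m → ℝ) (x' x'' : Fin m → X) : ℝ≥0∞ :=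
  ⨅ (τ : Fin m → ℝ) (_ : ∀ j, τ j ≠ 0),
    eLpNorm τ (conjIdx q s) Measure.count * weakNorm x₀ s (fun j => σ j / τ j) x' x''

/-- `T` is Lipschitz `(m^L(s;q),p)`-summing:
`m^L_{(s;q)}(σ,Tx',Tx'') ≤ C ⬝ ‖(σ,x',x'')|ℓ_p^{L,w}‖` for all finite sequences. -/
def LipMixedP {X Y : Type*} [MetricSpace X] [MetricSpace Y] (x₀ : X) (y₀ : Y)
    (s q p : ℝ≥0∞) (T : X → Y) : Prop :=
  ∃ C : ℝ≥0, ∀ (m : ℕ) (σ : Fin m → ℝ) (x' x'' : Fin m → X),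
    mixedNorm y₀ s q σ (T ∘ x') (T ∘ x'') ≤ C * weakNorm x₀ p σ x' x''

/-- The norm `π^L_{(m^L(s;q),p)}(T)`, the least constant in the defining inequality. -/
def lipMixedPNorm {X Y : Type*} [MetricSpace X] [MetricSpace Y] (x₀ : X) (y₀ : Y)
    (s q p : ℝ≥0∞) (T : X → Y) : ℝ≥0∞ :=
  sInf {C : ℝ≥0∞ | ∀ (m : ℕ) (σ : Fin m → ℝ) (x' x'' : Fin m → X),
    mixedNorm y₀ s q σ (T ∘ x') (T ∘ x'') ≤ C * weakNorm x₀ p σ x' x''}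

/-- `T` is Lipschitz `(p,m^L(s;q))`-summing:
`‖(σ,Tx',Tx'')|ℓ_p‖ ≤ C ⬝ m^L_{(s;q)}(σ,x',x'')` for all finite sequences. -/
def LipPMixed {X Y : Type*} [MetricSpace X] [MetricSpace Y] (x₀ : X)
    (p s q : ℝ≥0∞) (T : X → Y) : Prop :=
  ∃ C : ℝ≥0, ∀ (m : ℕ) (σ : Fin m → ℝ) (x' x'' : Fin m → X),
    strongNorm p σ (T ∘ x') (T ∘ x'') ≤ C * mixedNorm x₀ s q σ x' x''

/-- The norm `π^L_{(p,m^L(s;q))}(T)`, the least constant in the defining inequality. -/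
def lipPMixedNorm {X Y : Type*} [MetricSpace X] [MetricSpace Y] (x₀ : X)
    (p s q : ℝ≥0∞) (T : X → Y) : ℝ≥0∞ :=
  sInf {C : ℝ≥0∞ | ∀ (m : ℕ) (σ : Fin m → ℝ) (x' x'' : Fin m → X),
    strongNorm p σ (T ∘ x') (T ∘ x'') ≤ C * mixedNorm x₀ s q σ x' x''}

/-- The Lipschitz constant of a map, as an element of `ℝ≥0∞` (equal to `∞` if the map is
not Lipschitz). -/
def lipConst {α β : Type*} [PseudoEMetricSpace α] [PseudoEMetricSpace β] (f : α → β) : ℝ≥0∞ :=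
  ⨅ (K : ℝ≥0) (_ : LipschitzWith K f), (K : ℝ≥0∞)


/-- Weak Lipschitz `ℓ_p` norm for `ℕ`-indexed sequences. -/
def weakNormNat {X : Type*} [MetricSpace X] (x₀ : X) (p : ℝ≥0∞)
    (σ : ℕ → ℝ) (x' x'' : ℕ → X) : ℝ≥0∞ :=
  ⨆ f ∈ dualBall X x₀, eLpNorm (fun j => σ j * (f (x' j) - f (x'' j))) p Measure.count

/-- The sequence `(σ,x',x'')` is Lipschitz mixed `(s;q)`-summable: there exists a sequence `τ`
of nonzero reals with `τ ∈ ℓ_{s'(q)}` and `‖(σ/τ,x',x'')|ℓ_s^{L,w}‖ < ∞`. -/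
def LipMixedSummable {X : Type*} [MetricSpace X] (x₀ : X) (s q : ℝ≥0∞)
    (σ : ℕ → ℝ) (x' x'' : ℕ → X) : Prop :=
  ∃ τ : ℕ → ℝ, (∀ j, τ j ≠ 0) ∧ eLpNorm τ (conjIdx q s) Measure.count < ∞ ∧
    weakNormNat x₀ s (fun j => σ j / τ j) x' x'' < ∞

/-- Lipschitz mixed `(s;q)`-norm for `ℕ`-indexed sequences. -/
def mixedNormNat {X : Type*} [MetricSpace X] (x₀ : X) (s q : ℝ≥0∞)
    (σ : ℕ → ℝ) (x' x'' : ℕ → X) : ℝ≥0∞ :=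
  ⨅ (τ : ℕ → ℝ) (_ : ∀ j, τ j ≠ 0) (_ : eLpNorm τ (conjIdx q s) Measure.count < ∞),
    eLpNorm τ (conjIdx q s) Measure.count * weakNormNat x₀ s (fun j => σ j / τ j) x' x''

/-- The unit ball `B_{X^#}` of the Lipschitz dual, as a type carrying the topology of
pointwise convergence and its Borel σ-algebra. -/
structure DualBallT (X : Type*) [MetricSpace X] (x₀ : X) where
  toFun : X → ℝ
  lipschitz : LipschitzWith 1 toFun
  vanish : toFun x₀ = 0

instance {X : Type*} [MetricSpace X] {x₀ : X} : TopologicalSpace (DualBallT X x₀) :=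
  TopologicalSpace.induced DualBallT.toFun inferInstance

noncomputable instance {X : Type*} [MetricSpace X] {x₀ : X} :
    MeasurableSpace (DualBallT X x₀) := borel _

theorem fin_opt {n : ℕ} (θ : ℝ) (h0 : 0 < θ) (S : Set (Fin n → ℝ))
    (hS : IsCompact S) (hne : S.Nonempty) (hc : Convex ℝ S) (hpos : ∀ a ∈ S, ∀ j, 0 < a j) :
    ∃ a ∈ S, ∀ y ∈ S, ∑ j, (a j) ^ (θ - 1) * y j ≤ ∑ j, (a j) ^ θ := by
  obtain ⟨a, haS, hmax⟩ := hS.exists_isMaxOn (f := fun a : Fin n → ℝ => ∑ j, (a j) ^ θ) hne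
    (Continuous.continuousOn (continuous_finsetSum _ fun j _ =>
      (continuous_apply j).rpow_const fun _ => Or.inr h0.le))
  refine ⟨a, haS, fun y hy => ?_⟩
  have hd : HasFDerivAt (fun a : Fin n → ℝ => ∑ j, (a j) ^ θ)
      (∑ j, (θ * a j ^ (θ - 1)) • (ContinuousLinearMap.proj j : (Fin n → ℝ) →L[ℝ] ℝ)) a := by
    apply HasFDerivAt.fun_sum
    intro j _
    exact ((ContinuousLinearMap.proj j : (Fin n → ℝ) →L[ℝ] ℝ).hasFDerivAt (x := a)).rpow_const
      (Or.inl (hpos a haS j).ne')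
  have := hmax.localize.hasFDerivWithinAt_nonpos hd.hasFDerivWithinAt
    (sub_mem_posTangentConeAt_of_segment_subset (hc.segment_subset haS hy))
  simp only [_root_.sum_apply, _root_.smul_apply,
    ContinuousLinearMap.proj_apply, Pi.sub_apply, smul_eq_mul, mul_assoc, ← Finset.mul_sum] at this
  have h2 : ∑ j, a j ^ (θ - 1) * (y j - a j) ≤ 0 := by
    by_contra h; push Not at h; nlinarith [mul_pos h0 h]
  have h3 : ∑ j, a j ^ (θ - 1) * (y j - a j) = ∑ j, (a j) ^ (θ - 1) * y j - ∑ j, (a j) ^ θ := by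
    rw [← Finset.sum_sub_distrib]
    refine Finset.sum_congr rfl fun j _ => ?_
    rw [mul_sub]
    congr 1
    rw [← Real.rpow_add_one (hpos a haS j).ne']; simp
  linarith

theorem lim_opt {K : Type*} [TopologicalSpace K] [CompactSpace K] [Nonempty K]
    (θ : ℝ) (h0 : 0 < θ) (φ : ℕ → K → ℝ) (hφ : ∀ j, Continuous (φ j))
    (hφ0 : ∀ j k, 0 ≤ φ j k) (ε : ℕ → ℝ) (hε : ∀ j, 0 < ε j) (B : ℝ)
    (hB : ∀ n : ℕ, ∀ a ∈ convexHull ℝ (Set.range (fun (k : K) (j : Fin n) => φ j k + ε j)),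
      ∑ j, (a j) ^ θ ≤ B) :
    ∃ b : ℕ → ℝ, (∀ j, 0 < b j) ∧ (∀ n, ∑ j ∈ Finset.range n, b j ^ θ ≤ B) ∧
      ∀ n k, ∑ j ∈ Finset.range n, b j ^ (θ - 1) * φ j k ≤ B := by
  have hB : ∀ n : ℕ, ∀ a ∈ closure <| convexHull ℝ
      (Set.range (fun (k : K) (j : Fin n) => φ j k + ε j)), ∑ j, (a j) ^ θ ≤ B := by
    intro n
    have : closure (convexHull ℝ (Set.range (fun (k : K) (j : Fin n) => φ j k + ε j))) ⊆
        {a : Fin n → ℝ | ∑ j, (a j) ^ θ ≤ B} := by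
      refine closure_minimal (fun a ha => hB n a ha) (isClosed_le ?_ continuous_const)
      exact continuous_finsetSum _ fun j _ => (continuous_apply j).rpow_const fun _ => Or.inr h0.le
    exact fun a ha => this ha
  have hlow : ∀ n : ℕ, ∀ a ∈ closure <| convexHull ℝ (Set.range (fun (k : K) (j : Fin n) => φ j k + ε j)),
      ∀ j : Fin n, ε j ≤ a j := by
    intro n
    have : closure (convexHull ℝ (Set.range (fun (k : K) (j : Fin n) => φ j k + ε j))) ⊆
        Set.Ici (fun j : Fin n => ε j) := by
      refine closure_minimal (convexHull_min ?_ (convex_Ici _)) isClosed_Ici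
      rintro _ ⟨k, rfl⟩ j
      simp [hφ0]
    exact fun a ha j => this ha j
  have hfin : ∀ n : ℕ, ∃ a ∈ closure <| convexHull ℝ (Set.range (fun (k : K) (j : Fin n) => φ j k + ε j)),
      ∀ y ∈ closure <| convexHull ℝ (Set.range (fun (k : K) (j : Fin n) => φ j k + ε j)),
       ∑ j, (a j) ^ (θ - 1) * y j ≤ ∑ j, (a j) ^ θ := by
    intro n
    apply fin_opt θ h0
    · apply Metric.isCompact_of_isClosed_isBounded isClosed_closure
      apply Bornology.IsBounded.closure
      rw [isBounded_convexHull]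
      exact (isCompact_range (by fun_prop)).isBounded
    · exact (Set.range_nonempty _).convexHull.closure
    · exact (convex_convexHull _ _).closure
    · exact fun a ha j => (hε j).trans_le (hlow n a ha j)
  choose a haS ha using hfin
  let A : ℕ → ℕ → ℝ := fun n j => if h : j < n then a n ⟨j, h⟩ else ε j
  have hAlow : ∀ n j, ε j ≤ A n j := by
    intro n j
    simp only [A]; split_ifs with h
    · exact hlow n _ (haS n) ⟨j, h⟩
    · exact le_rfl
  have hA0 : ∀ n j, 0 < A n j := fun n j => (hε j).trans_le (hAlow n j)
  have hsum1 : ∀ n, ∑ j ∈ Finset.range n, A n j ^ θ ≤ B := by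
    intro n
    rw [Finset.sum_range]
    simpa [A] using hB n (a n) (haS n)
  have hsum2 : ∀ n k, ∑ j ∈ Finset.range n, A n j ^ (θ - 1) * φ j k ≤ B := by
    intro n k
    refine le_trans ?_ (hB n (a n) (haS n))
    refine le_trans ?_ (ha n _ (subset_closure (subset_convexHull ℝ _ ⟨k, rfl⟩)))
    rw [Finset.sum_range]
    refine Finset.sum_le_sum fun j _ => ?_
    have : A n j = a n j := by simp [A]
    rw [this]
    have h3 := hA0 n j
    rw [this] at h3
    have := hε j
    gcongr
    linarith
  have hB0 : 0 ≤ B := by simpa using hsum1 0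
  have hAup : ∀ n j, A n j ≤ max (ε j) (B ^ (1 / θ)) := by
    intro n j
    by_cases h : j < n
    · apply le_max_of_le_right
      rw [one_div, Real.le_rpow_inv_iff_of_pos (hA0 n j).le hB0 h0]
      refine le_trans ?_ (hsum1 n)
      exact Finset.single_le_sum (f := fun j => A n j ^ θ)
        (fun i _ => Real.rpow_nonneg (hA0 n i).le _) (Finset.mem_range.2 h)
    · apply le_max_of_le_left; simp [A, h]
  have hcpt : IsCompact (Set.pi Set.univ fun j : ℕ => Set.Icc (ε j) (max (ε j) (B ^ (1 / θ)))) :=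
    isCompact_univ_pi fun j => isCompact_Icc
  obtain ⟨b, hb, hlim⟩ := hcpt.ultrafilter_le_nhds ((Filter.hyperfilter ℕ).map A) (by
    simp only [Ultrafilter.coe_map, Filter.le_principal_iff, Filter.mem_map]
    exact Filter.univ_mem' fun n j _ => ⟨hAlow n j, hAup n j⟩)
  have hlim' : ∀ j, Filter.Tendsto (fun n => A n j) (Filter.hyperfilter ℕ) (nhds (b j)) := by
    have : Filter.Tendsto A (Filter.hyperfilter ℕ) (nhds b) := hlim
    exact tendsto_pi_nhds.1 this
  have hb0 : ∀ j, 0 < b j := fun j => (hε j).trans_le (hb j trivial).1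
  have hev : ∀ N : ℕ, ∀ᶠ n in (Filter.hyperfilter ℕ : Filter ℕ), N ≤ n := fun N =>
    Nat.hyperfilter_le_atTop (Filter.eventually_ge_atTop N)
  refine ⟨b, hb0, fun N => ?_, fun N k => ?_⟩
  · refine le_of_tendsto (tendsto_finsetSum _ fun j _ => (hlim' j).rpow_const (Or.inl (hb0 j).ne'))
      ((hev N).mono fun n hn => ?_)
    exact (Finset.sum_le_sum_of_subset_of_nonneg (by simpa using hn)
      fun i _ _ => Real.rpow_nonneg (hA0 n i).le _).trans (hsum1 n)
  · refine le_of_tendsto (tendsto_finsetSum _ fun j _ =>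
      ((hlim' j).rpow_const (Or.inl (hb0 j).ne')).mul_const (φ j k))
      ((hev N).mono fun n hn => ?_)
    exact (Finset.sum_le_sum_of_subset_of_nonneg (by simpa using hn)
      fun i _ _ => mul_nonneg (Real.rpow_nonneg (hA0 n i).le _) (hφ0 _ _)).trans (hsum2 n k)

theorem hull_meas {K : Type*} [MeasurableSpace K] {n : ℕ} (ψ : Fin n → K → ℝ)
    (hψm : ∀ j, Measurable (ψ j)) (hψ : ∀ j k, 0 ≤ ψ j k) (a : Fin n → ℝ)
    (ha : a ∈ convexHull ℝ (Set.range (fun (k : K) (j : Fin n) => ψ j k))) :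
    ∃ μ : Measure K, IsProbabilityMeasure μ ∧ ∀ j, 0 ≤ a j ∧
      ENNReal.ofReal (a j) = ∫⁻ k, ENNReal.ofReal (ψ j k) ∂μ := by
  have : convexHull ℝ (Set.range (fun (k : K) (j : Fin n) => ψ j k)) ⊆
      {a | ∃ μ : Measure K, IsProbabilityMeasure μ ∧ ∀ j, 0 ≤ a j ∧
        ENNReal.ofReal (a j) = ∫⁻ k, ENNReal.ofReal (ψ j k) ∂μ} := by
    apply convexHull_min
    · rintro _ ⟨k, rfl⟩
      refine ⟨Measure.dirac k, inferInstance, fun j => ⟨hψ j k, ?_⟩⟩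
      rw [lintegral_dirac' _ ((hψm j).ennreal_ofReal)]
    · rintro a ⟨μ, hμ, ha⟩ b ⟨ν, hν, hb⟩ s t hs ht hst
      refine ⟨ENNReal.ofReal s • μ + ENNReal.ofReal t • ν, ⟨?_⟩, fun j => ⟨?_, ?_⟩⟩
      · simp [← ENNReal.ofReal_add hs ht, hst]
      · have := (ha j).1
        have := (hb j).1
        simp only [Pi.add_apply, Pi.smul_apply, smul_eq_mul]
        positivity
      · have h1 := (ha j).1
        have h2 := (hb j).1
        simp only [Pi.add_apply, Pi.smul_apply, smul_eq_mul]
        rw [ENNReal.ofReal_add (by positivity) (by positivity), ENNReal.ofReal_mul hs,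
          ENNReal.ofReal_mul ht, (ha j).2, (hb j).2, lintegral_add_measure, lintegral_smul_measure,
          lintegral_smul_measure, smul_eq_mul, smul_eq_mul]
  exact this ha

theorem core_opt {K : Type*} [TopologicalSpace K] [CompactSpace K] [Nonempty K]
    [MeasurableSpace K] [BorelSpace K]
    (θ : ℝ) (h0 : 0 < θ) (h1 : θ < 1) (φ : ℕ → K → ℝ) (hφ : ∀ j, Continuous (φ j))
    (hφ0 : ∀ j k, 0 ≤ φ j k) (M δ : ℝ≥0∞) (hM : M ≠ ∞) (hδ0 : δ ≠ 0) (hδ : δ ≠ ∞)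
    (hT : ∀ μ : Measure K, IsProbabilityMeasure μ →
      ∑' j, (∫⁻ k, ENNReal.ofReal (φ j k) ∂μ) ^ θ ≤ M) :
    ∃ b : ℕ → ℝ, (∀ j, 0 < b j) ∧ (∑' j, ENNReal.ofReal (b j ^ θ) ≤ M + δ) ∧
      ∀ k, ∑' j, ENNReal.ofReal (b j ^ (θ - 1) * φ j k) ≤ M + δ := by
  obtain ⟨e, he0, he⟩ := ENNReal.exists_pos_sum_of_countable hδ0 ℕ
  have htop : M + δ ≠ ∞ := ENNReal.add_ne_top.2 ⟨hM, hδ⟩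
  obtain ⟨b, hb0, hb1, hb2⟩ := lim_opt θ h0 φ hφ hφ0 (fun j => (e j : ℝ) ^ (1 / θ))
    (fun j => Real.rpow_pos_of_pos (he0 j) _) (M + δ).toReal (by
      intro n a ha
      obtain ⟨μ, hμ, h⟩ := hull_meas (fun (j : Fin n) k => φ j k + (e j : ℝ) ^ (1 / θ))
        (fun j => ((hφ j).measurable.add_const _)) (fun j k => add_nonneg (hφ0 _ _) (by positivity))
        a ha
      rw [← ENNReal.ofReal_le_iff_le_toReal htop,
        ENNReal.ofReal_sum_of_nonneg (fun j _ => Real.rpow_nonneg (h j).1 _)]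
      calc ∑ j, ENNReal.ofReal (a j ^ θ)
          ≤ ∑ j : Fin n, ((∫⁻ k, ENNReal.ofReal (φ j k) ∂μ) ^ θ + (e j : ℝ≥0∞)) := by
            refine Finset.sum_le_sum fun j _ => ?_
            rw [← ENNReal.ofReal_rpow_of_nonneg (h j).1 h0.le, (h j).2]
            have : ∫⁻ k, ENNReal.ofReal (φ j k + (e j : ℝ) ^ (1 / θ)) ∂μ =
                ∫⁻ k, ENNReal.ofReal (φ j k) ∂μ + (e j : ℝ≥0∞) ^ (1 / θ) := by
              have h5 : ∀ k, ENNReal.ofReal (φ j k + (e j : ℝ) ^ (1 / θ)) =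
                  ENNReal.ofReal (φ j k) + (e j : ℝ≥0∞) ^ (1 / θ) := by
                intro k
                rw [ENNReal.ofReal_add (hφ0 _ _) (by positivity),
                  ← ENNReal.ofReal_rpow_of_nonneg (by positivity) (by positivity),
                  ENNReal.ofReal_coe_nnreal]
              simp only [h5]
              rw [lintegral_add_right _ measurable_const]
              simp
            rw [this]
            refine (ENNReal.rpow_add_le_add_rpow _ _ h0.le h1.le).trans ?_
            rw [← ENNReal.rpow_mul, one_div, inv_mul_cancel₀ h0.ne', ENNReal.rpow_one]
        _ = ∑ j ∈ Finset.range n, ((∫⁻ k, ENNReal.ofReal (φ j k) ∂μ) ^ θ + (e j : ℝ≥0∞)) := by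
            rw [Finset.sum_range]
        _ ≤ ∑' j, ((∫⁻ k, ENNReal.ofReal (φ j k) ∂μ) ^ θ + (e j : ℝ≥0∞)) :=
            ENNReal.sum_le_tsum _
        _ ≤ M + δ := by
            rw [ENNReal.tsum_add]
            exact add_le_add (hT μ hμ) he.le)
  refine ⟨b, hb0, ?_, fun k => ?_⟩
  · refine ENNReal.tsum_le_of_sum_range_le fun n => ?_
    rw [← ENNReal.ofReal_sum_of_nonneg (fun j _ => Real.rpow_nonneg (hb0 j).le _),
      ENNReal.ofReal_le_iff_le_toReal htop]
    exact hb1 n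
  · refine ENNReal.tsum_le_of_sum_range_le fun n => ?_
    rw [← ENNReal.ofReal_sum_of_nonneg
      (fun j _ => mul_nonneg (Real.rpow_nonneg (hb0 j).le _) (hφ0 _ _)),
      ENNReal.ofReal_le_iff_le_toReal htop]
    exact hb2 n k

theorem sup_finite {K : Type*} [MeasurableSpace K] (θ : ℝ) (h0 : 0 < θ)
    (φ : ℕ → K → ℝ≥0∞)
    (hT : ∀ μ : Measure K, IsProbabilityMeasure μ → ∑' j, (∫⁻ k, φ j k ∂μ) ^ θ < ∞) :
    ∃ M : ℝ≥0∞, M ≠ ∞ ∧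
      ∀ μ : Measure K, IsProbabilityMeasure μ → ∑' j, (∫⁻ k, φ j k ∂μ) ^ θ ≤ M := by
  by_contra! h
  have h2 : ∀ n : ℕ, ((2⁻¹ : ℝ≥0∞) ^ (n + 1)) ^ θ ≠ 0 := fun n => by
    rw [Ne, ENNReal.rpow_eq_zero_iff_of_pos h0]; simp
  have h3 : ∀ n : ℕ, ((2⁻¹ : ℝ≥0∞) ^ (n + 1)) ^ θ ≠ ∞ := fun n => 
    ENNReal.rpow_ne_top_of_nonneg h0.le (by simp)
  have h4 : ∀ n : ℕ, ∃ μ : Measure K, IsProbabilityMeasure μ ∧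
      (((2⁻¹ : ℝ≥0∞) ^ (n + 1)) ^ θ)⁻¹ * n < ∑' j, (∫⁻ k, φ j k ∂μ) ^ θ := fun n =>
    h _ (ENNReal.mul_ne_top (by simp) (by simp))
  choose μ hμ hlt using h4
  let ν : Measure K := Measure.sum fun n => ((2⁻¹ : ℝ≥0∞) ^ (n + 1)) • μ n
  have hν : IsProbabilityMeasure ν := by
    constructor
    simp [ν, Measure.sum_apply, ENNReal.tsum_geometric_add_one]
    exact ENNReal.inv_mul_cancel (by simp) (by simp)
  have hge : ∀ n : ℕ, (n : ℝ≥0∞) ≤ ∑' j, (∫⁻ k, φ j k ∂ν) ^ θ := by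
    intro n
    calc (n : ℝ≥0∞) = ((2⁻¹ : ℝ≥0∞) ^ (n + 1)) ^ θ * ((((2⁻¹ : ℝ≥0∞) ^ (n + 1)) ^ θ)⁻¹ * n) := by
          rw [← mul_assoc, ENNReal.mul_inv_cancel (h2 n) (h3 n), one_mul]
      _ ≤ ((2⁻¹ : ℝ≥0∞) ^ (n + 1)) ^ θ * ∑' j, (∫⁻ k, φ j k ∂(μ n)) ^ θ := by
          gcongr; exact (hlt n).le
      _ = ∑' j, ((2⁻¹ : ℝ≥0∞) ^ (n + 1) * ∫⁻ k, φ j k ∂(μ n)) ^ θ := by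
          rw [← ENNReal.tsum_mul_left]
          simp_rw [ENNReal.mul_rpow_of_nonneg _ _ h0.le]
      _ ≤ _ := by
          refine ENNReal.tsum_le_tsum fun j => ENNReal.rpow_le_rpow ?_ h0.le
          rw [lintegral_sum_measure]
          refine le_trans ?_ (ENNReal.le_tsum n)
          rw [lintegral_smul_measure, smul_eq_mul]
  obtain ⟨n, hn⟩ := ENNReal.exists_nat_gt (hT ν hν).ne
  exact absurd (hge n) (not_le.2 hn)

theorem holder_tsum (θ : ℝ) (h0 : 0 < θ) (h1 : θ < 1) (u v : ℕ → ℝ≥0∞) :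
    ∑' j, u j ^ (1 - θ) * v j ^ θ ≤ (∑' j, u j) ^ (1 - θ) * (∑' j, v j) ^ θ := by
  have := ENNReal.lintegral_mul_norm_pow_le (α := ℕ) (μ := Measure.count) (f := u) (g := v)
    (by fun_prop) (by fun_prop) (p := 1 - θ) (q := θ) (by linarith) h0.le (by ring)
  simpa [lintegral_count] using this

instance dbt_borel {X : Type*} [MetricSpace X] {x₀ : X} : BorelSpace (DualBallT X x₀) := ⟨rfl⟩

instance dbt_nonempty {X : Type*} [MetricSpace X] {x₀ : X} : Nonempty (DualBallT X x₀) :=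
  ⟨⟨fun _ => 0, LipschitzWith.const' 0, rfl⟩⟩

theorem dbt_inducing {X : Type*} [MetricSpace X] {x₀ : X} :
    Topology.IsInducing (DualBallT.toFun : DualBallT X x₀ → X → ℝ) := ⟨rfl⟩

theorem dbt_eval {X : Type*} [MetricSpace X] {x₀ : X} (x : X) :
    Continuous (fun f : DualBallT X x₀ => f.toFun x) :=
  (continuous_apply x).comp dbt_inducing.continuous

instance dbt_compact {X : Type*} [MetricSpace X] {x₀ : X} : CompactSpace (DualBallT X x₀) := by
  constructor
  rw [dbt_inducing.isCompact_iff, Set.image_univ]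
  have hr : Set.range (DualBallT.toFun : DualBallT X x₀ → X → ℝ) =
      {f | (∀ x y, dist (f x) (f y) ≤ dist x y) ∧ f x₀ = 0} := by
    ext f
    constructor
    · rintro ⟨g, rfl⟩
      exact ⟨fun x y => by simpa using g.lipschitz.dist_le_mul x y, g.vanish⟩
    · rintro ⟨h, h0⟩
      exact ⟨⟨f, LipschitzWith.of_dist_le_mul (by simpa using h), h0⟩, rfl⟩
  rw [hr]
  refine IsCompact.of_isClosed_subset
    (isCompact_univ_pi fun x : X => isCompact_closedBall (0 : ℝ) (dist x x₀)) ?_ ?_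
  · simp only [Set.setOf_and, Set.setOf_forall]
    refine IsClosed.inter (isClosed_iInter fun x => isClosed_iInter fun y => ?_) ?_
    · exact isClosed_le (by fun_prop) continuous_const
    · exact isClosed_eq (by fun_prop) continuous_const
  · rintro f ⟨h, h0⟩ x _
    have := h x x₀
    rw [h0] at this
    exact this

theorem eLpNorm_count_eq (p : ℝ≥0∞) (hp : p ≠ 0) (hp' : p ≠ ∞) (u : ℕ → ℝ) :
    eLpNorm u p Measure.count = (∑' j, ENNReal.ofReal |u j| ^ p.toReal) ^ (1 / p.toReal) := by
  rw [eLpNorm_eq_lintegral_rpow_enorm_toReal hp hp', lintegral_count]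
  simp_rw [Real.enorm_eq_ofReal_abs]

theorem conjIdx_facts (s q : ℝ≥0∞) (hq : 0 < q) (hqs : q < s) (hs : s ≠ ∞) :
    conjIdx q s ≠ 0 ∧ conjIdx q s ≠ ∞ ∧
      1 / (conjIdx q s).toReal = 1 / q.toReal - 1 / s.toReal := by
  have hq' : q ≠ ∞ := (hqs.trans_le le_top).ne
  have hlt : 1 / s < 1 / q := by
    rw [one_div, one_div]; exact ENNReal.inv_lt_inv.2 hqs
  have hqt : 1 / q ≠ ∞ := by simp [hq.ne']
  refine ⟨?_, ?_, ?_⟩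
  · rw [conjIdx, Ne, ENNReal.inv_eq_zero]
    exact ENNReal.sub_ne_top hqt
  · rw [conjIdx, Ne, ENNReal.inv_eq_top]
    exact (tsub_pos_of_lt hlt).ne'
  · rw [conjIdx, ENNReal.toReal_inv, one_div, inv_inv, ENNReal.toReal_sub_of_le hlt.le hqt]
    simp

theorem upper_bound {X : Type*} [MetricSpace X] (x₀ : X) (s q : ℝ≥0∞)
    (hq : 0 < q) (hqs : q < s) (hs : s ≠ ∞) (σ : ℕ → ℝ) (x' x'' : ℕ → X)
    (τ : ℕ → ℝ) (hτ : ∀ j, τ j ≠ 0)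
    (μ : Measure (DualBallT X x₀)) (hμ : IsProbabilityMeasure μ) :
    (∑' j, (∫⁻ f, (ENNReal.ofReal |σ j * (f.toFun (x' j) - f.toFun (x'' j))|) ^ s.toReal ∂μ)
      ^ (q.toReal / s.toReal)) ^ (1 / q.toReal) ≤
    eLpNorm τ (conjIdx q s) Measure.count * weakNormNat x₀ s (fun j => σ j / τ j) x' x'' := by
  obtain ⟨hc0, hct, hc⟩ := conjIdx_facts s q hq hqs hs
  have hq' : q ≠ ∞ := (hqs.trans_le le_top).ne
  have hs0 : s ≠ 0 := (hq.trans hqs).ne'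
  have hp : 0 < s.toReal := ENNReal.toReal_pos hs0 hs
  have hr : 0 < q.toReal := ENNReal.toReal_pos hq.ne' hq'
  have hrp : q.toReal < s.toReal := (ENNReal.toReal_lt_toReal hq' hs).2 hqs
  have hP : 0 < (conjIdx q s).toReal := ENNReal.toReal_pos hc0 hct
  set p := s.toReal
  set r := q.toReal
  set P := (conjIdx q s).toReal with hPdef
  have hθ0 : 0 < r / p := by positivity
  have hθ1 : r / p < 1 := (div_lt_one hp).2 hrp
  have hPθ : P * (1 - r / p) = r := by
    field_simp at hc ⊢
    linarith
  set W := weakNormNat x₀ s (fun j => σ j / τ j) x' x'' with hW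
  set c : ℕ → DualBallT X x₀ → ℝ≥0∞ := fun j f =>
    ENNReal.ofReal |σ j / τ j * (f.toFun (x' j) - f.toFun (x'' j))| ^ p with hcdef
  have hcm : ∀ j, Measurable (c j) := fun j => by
    have : Continuous (c j) := by
      have h1 := dbt_eval (x₀ := x₀) (x' j)
      have h2 := dbt_eval (x₀ := x₀) (x'' j)
      exact ENNReal.continuous_rpow_const.comp (ENNReal.continuous_ofReal.comp
        (continuous_const.mul (h1.sub h2)).abs)
    exact this.measurable
  have hcW : ∀ f, ∑' j, c j f ≤ W ^ p := by
    intro f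
    have h1 : eLpNorm (fun j => σ j / τ j * (f.toFun (x' j) - f.toFun (x'' j))) s Measure.count
        ≤ W := le_iSup₂_of_le (f := fun (f : X → ℝ) (_ : f ∈ dualBall X x₀) =>
          eLpNorm (fun j => σ j / τ j * (f (x' j) - f (x'' j))) s Measure.count)
          f.toFun ⟨f.lipschitz, f.vanish⟩ le_rfl
    rw [eLpNorm_count_eq s hs0 hs, one_div, ENNReal.rpow_inv_le_iff hp] at h1
    exact h1
  have hsc : ∑' j, ∫⁻ f, c j f ∂μ ≤ W ^ p := by
    rw [← lintegral_tsum fun j => (hcm j).aemeasurable]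
    calc ∫⁻ f, ∑' j, c j f ∂μ ≤ ∫⁻ f, W ^ p ∂μ := lintegral_mono hcW
      _ = W ^ p := by simp
  have hterm : ∀ j, (∫⁻ f, (ENNReal.ofReal |σ j * (f.toFun (x' j) - f.toFun (x'' j))|) ^ p ∂μ)
      ^ (r / p) = (ENNReal.ofReal |τ j| ^ P) ^ (1 - r / p) * (∫⁻ f, c j f ∂μ) ^ (r / p) := by
    intro j
    have h1 : ∀ f : DualBallT X x₀,
        (ENNReal.ofReal |σ j * (f.toFun (x' j) - f.toFun (x'' j))|) ^ p =
        ENNReal.ofReal |τ j| ^ p * c j f := by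
      intro f
      rw [hcdef]
      simp only
      rw [← ENNReal.mul_rpow_of_nonneg _ _ hp.le, ← ENNReal.ofReal_mul (abs_nonneg _), ← abs_mul]
      congr 3
      have := hτ j
      field_simp
    simp_rw [h1]
    rw [lintegral_const_mul _ (hcm j), ENNReal.mul_rpow_of_nonneg _ _ hθ0.le, ← ENNReal.rpow_mul,
      ← ENNReal.rpow_mul, hPθ, mul_div_cancel₀ _ hp.ne']
  simp_rw [hterm]
  rw [one_div, ENNReal.rpow_inv_le_iff hr]
  refine (holder_tsum _ hθ0 hθ1 _ _).trans ?_
  rw [ENNReal.mul_rpow_of_nonneg _ _ hr.le, eLpNorm_count_eq _ hc0 hct, ← ENNReal.rpow_mul]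
  refine mul_le_mul' (le_of_eq ?_) ?_
  · congr 1
    rw [← hPdef]
    field_simp
    field_simp at hPθ
    linarith
  · refine (ENNReal.rpow_le_rpow hsc hθ0.le).trans_eq ?_
    rw [← ENNReal.rpow_mul, mul_div_cancel₀ _ hp.ne']

theorem lower_bound {X : Type*} [MetricSpace X] (x₀ : X) (s q : ℝ≥0∞)
    (hq : 0 < q) (hqs : q < s) (hs : s ≠ ∞) (σ : ℕ → ℝ) (x' x'' : ℕ → X)
    (M δ : ℝ≥0∞) (hM : M ≠ ∞) (hδ0 : δ ≠ 0) (hδ : δ ≠ ∞)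
    (hT : ∀ μ : Measure (DualBallT X x₀), IsProbabilityMeasure μ →
      ∑' j, (∫⁻ f, (ENNReal.ofReal |σ j * (f.toFun (x' j) - f.toFun (x'' j))|) ^ s.toReal ∂μ)
        ^ (q.toReal / s.toReal) ≤ M) :
    ∃ τ : ℕ → ℝ, (∀ j, τ j ≠ 0) ∧
      eLpNorm τ (conjIdx q s) Measure.count ≤ (M + δ) ^ (1 / (conjIdx q s).toReal) ∧
      weakNormNat x₀ s (fun j => σ j / τ j) x' x'' ≤ (M + δ) ^ (1 / s.toReal) := by
  obtain ⟨hc0, hct, hc⟩ := conjIdx_facts s q hq hqs hs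
  have hq' : q ≠ ∞ := (hqs.trans_le le_top).ne
  have hs0 : s ≠ 0 := (hq.trans hqs).ne'
  have hp : 0 < s.toReal := ENNReal.toReal_pos hs0 hs
  have hr : 0 < q.toReal := ENNReal.toReal_pos hq.ne' hq'
  have hrp : q.toReal < s.toReal := (ENNReal.toReal_lt_toReal hq' hs).2 hqs
  have hP : 0 < (conjIdx q s).toReal := ENNReal.toReal_pos hc0 hct
  set p := s.toReal with hpdef
  set r := q.toReal
  set P := (conjIdx q s).toReal with hPdef
  have hθ0 : 0 < r / p := by positivity
  have hθ1 : r / p < 1 := (div_lt_one hp).2 hrp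
  have hPθ : P * (1 - r / p) = r := by
    field_simp at hc ⊢
    linarith
  obtain ⟨b, hb0, hb1, hb2⟩ := core_opt (K := DualBallT X x₀) (r / p) hθ0 hθ1
    (fun j f => |σ j * (f.toFun (x' j) - f.toFun (x'' j))| ^ p)
    (fun j => ((continuous_const.mul ((dbt_eval _).sub (dbt_eval _))).abs).rpow_const
      fun _ => Or.inr hp.le)
    (fun j f => by positivity) M δ hM hδ0 hδ (by
      intro μ hμ
      simp_rw [← ENNReal.ofReal_rpow_of_nonneg (abs_nonneg _) hp.le]
      exact hT μ hμ)
  have hτ0 : ∀ j, 0 < b j ^ ((1 - r / p) / p) := fun j => Real.rpow_pos_of_pos (hb0 j) _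
  refine ⟨fun j => b j ^ ((1 - r / p) / p), fun j => (hτ0 j).ne', ?_, ?_⟩
  · rw [eLpNorm_count_eq _ hc0 hct]
    refine ENNReal.rpow_le_rpow (le_trans (le_of_eq ?_) hb1) (by positivity)
    refine tsum_congr fun j => ?_
    rw [abs_of_pos (hτ0 j), ← hPdef, ENNReal.ofReal_rpow_of_nonneg (hτ0 j).le hP.le,
      ← Real.rpow_mul (hb0 j).le]
    congr 2
    rw [← hPθ]
    rw [hPθ]
    field_simp
    field_simp at hPθ
    linarith
  · refine iSup₂_le fun f hf => ?_
    rw [eLpNorm_count_eq _ hs0 hs]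
    refine ENNReal.rpow_le_rpow (le_trans (le_of_eq ?_) (hb2 ⟨f, hf.1, hf.2⟩)) (by positivity)
    refine tsum_congr fun j => ?_
    rw [← hpdef, ENNReal.ofReal_rpow_of_nonneg (abs_nonneg _) hp.le]
    congr 1
    simp only
    have h1 : σ j / b j ^ ((1 - r / p) / p) * (f (x' j) - f (x'' j)) =
      (b j ^ ((1 - r / p) / p))⁻¹ * (σ j * (f (x' j) - f (x'' j))) := by ring
    rw [h1, abs_mul, abs_of_pos (inv_pos.2 (hτ0 j)), Real.mul_rpow (inv_pos.2 (hτ0 j)).le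
      (abs_nonneg _), ← Real.rpow_neg (hb0 j).le, ← Real.rpow_mul (hb0 j).le]
    congr 2
    field_simp
    ring

/-- for `0 < q < s < ∞`, a sequence is Lipschitz mixed `(s;q)`-summable iff
`[Σ_j (∫_{B_{X^#}} |σ_j|^s |f(x'_j)-f(x''_j)|^s dμ)^{q/s}]^{1/q} < ∞` for every Borel
probability measure `μ` on `B_{X^#}`, and in that case the supremum of these quantities over
all such `μ` equals `m^L_{(s;q)}(σ,x',x'')`. -/
theorem stmt0 {X : Type*} [MetricSpace X] (x₀ : X) (s q : ℝ≥0∞)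
    (hq : 0 < q) (hqs : q < s) (hs : s ≠ ∞)
    (σ : ℕ → ℝ) (x' x'' : ℕ → X) :
    (LipMixedSummable x₀ s q σ x' x'' ↔
      ∀ μ : Measure (DualBallT X x₀), IsProbabilityMeasure μ →
        (∑' j, (∫⁻ f, (ENNReal.ofReal |σ j * (f.toFun (x' j) - f.toFun (x'' j))|) ^ s.toReal ∂μ)
            ^ (q.toReal / s.toReal)) ^ (1 / q.toReal) < ∞) ∧
    (LipMixedSummable x₀ s q σ x' x'' →
      (⨆ (μ : Measure (DualBallT X x₀)) (_ : IsProbabilityMeasure μ),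
          (∑' j, (∫⁻ f, (ENNReal.ofReal |σ j * (f.toFun (x' j) - f.toFun (x'' j))|) ^ s.toReal ∂μ)
              ^ (q.toReal / s.toReal)) ^ (1 / q.toReal))
        = mixedNormNat x₀ s q σ x' x'') := by
  have hq' : q ≠ ∞ := (hqs.trans_le le_top).ne
  have hr : 0 < q.toReal := ENNReal.toReal_pos hq.ne' hq'
  have hs0 : s ≠ 0 := (hq.trans hqs).ne'
  have hp : 0 < s.toReal := ENNReal.toReal_pos hs0 hs
  obtain ⟨hc0, hct, hc⟩ := conjIdx_facts s q hq hqs hs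
  have hP : 0 < (conjIdx q s).toReal := ENNReal.toReal_pos hc0 hct
  refine ⟨⟨?_, ?_⟩, ?_⟩
  · rintro ⟨τ, hτ, h1, h2⟩ μ hμ
    exact (upper_bound x₀ s q hq hqs hs σ x' x'' τ hτ μ hμ).trans_lt (ENNReal.mul_lt_top h1 h2)
  · intro h
    obtain ⟨M, hM, hT⟩ := sup_finite (K := DualBallT X x₀) (q.toReal / s.toReal) (by positivity)
      (fun j f => (ENNReal.ofReal |σ j * (f.toFun (x' j) - f.toFun (x'' j))|) ^ s.toReal)
      (fun μ hμ => by
        have := h μ hμ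
        rwa [ENNReal.rpow_lt_top_iff_of_pos (by positivity)] at this)
    obtain ⟨τ, hτ, h1, h2⟩ := lower_bound x₀ s q hq hqs hs σ x' x'' M 1 hM one_ne_zero
      ENNReal.one_ne_top hT
    have htop : M + 1 < ∞ := ENNReal.add_lt_top.2 ⟨hM.lt_top, ENNReal.one_lt_top⟩
    exact ⟨τ, hτ, h1.trans_lt (ENNReal.rpow_lt_top_of_nonneg (by positivity) htop.ne),
      h2.trans_lt (ENNReal.rpow_lt_top_of_nonneg (by positivity) htop.ne)⟩
  · rintro ⟨τ₀, hτ₀, h1₀, h2₀⟩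
    apply le_antisymm
    · refine iSup₂_le fun μ hμ => le_iInf fun τ => le_iInf fun hτ => le_iInf fun _ => ?_
      exact upper_bound x₀ s q hq hqs hs σ x' x'' τ hτ μ hμ
    · set N := ⨆ (μ : Measure (DualBallT X x₀)) (_ : IsProbabilityMeasure μ),
          (∑' j, (∫⁻ f, (ENNReal.ofReal |σ j * (f.toFun (x' j) - f.toFun (x'' j))|)
            ^ s.toReal ∂μ) ^ (q.toReal / s.toReal)) ^ (1 / q.toReal) with hN
      have hNtop : N ≠ ∞ := by
        refine (lt_of_le_of_lt ?_ (ENNReal.mul_lt_top h1₀ h2₀)).ne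
        exact iSup₂_le fun μ hμ => upper_bound x₀ s q hq hqs hs σ x' x'' τ₀ hτ₀ μ hμ
      have hMtop : N ^ q.toReal ≠ ∞ := ENNReal.rpow_ne_top_of_nonneg hr.le hNtop
      have hT : ∀ μ : Measure (DualBallT X x₀), IsProbabilityMeasure μ →
          ∑' j, (∫⁻ f, (ENNReal.ofReal |σ j * (f.toFun (x' j) - f.toFun (x'' j))|)
            ^ s.toReal ∂μ) ^ (q.toReal / s.toReal) ≤ N ^ q.toReal := by
        intro μ hμ
        rw [← ENNReal.rpow_inv_le_iff hr, ← one_div]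
        exact le_iSup₂_of_le (f := fun (μ : Measure (DualBallT X x₀))
          (_ : IsProbabilityMeasure μ) =>
          (∑' j, (∫⁻ f, (ENNReal.ofReal |σ j * (f.toFun (x' j) - f.toFun (x'' j))|)
            ^ s.toReal ∂μ) ^ (q.toReal / s.toReal)) ^ (1 / q.toReal)) μ hμ le_rfl
      rw [one_div, one_div, one_div] at hc
      have hsumexp : 1 / (conjIdx q s).toReal + 1 / s.toReal = q.toReal⁻¹ := by
        rw [one_div, one_div]; linarith
      have hle : mixedNormNat x₀ s q σ x' x'' ^ q.toReal ≤ N ^ q.toReal := by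
        refine ENNReal.le_of_forall_pos_le_add fun δ hδ _ => ?_
        obtain ⟨τ, hτ, h1, h2⟩ := lower_bound x₀ s q hq hqs hs σ x' x'' (N ^ q.toReal) δ hMtop
          (by exact_mod_cast hδ.ne') ENNReal.coe_ne_top hT
        have htop : N ^ q.toReal + δ ≠ ∞ := ENNReal.add_ne_top.2 ⟨hMtop, ENNReal.coe_ne_top⟩
        rw [← ENNReal.le_rpow_inv_iff hr]
        have hm : mixedNormNat x₀ s q σ x' x'' ≤
            eLpNorm τ (conjIdx q s) Measure.count *
              weakNormNat x₀ s (fun j => σ j / τ j) x' x'' :=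
          iInf_le_of_le τ (iInf_le_of_le hτ (iInf_le_of_le
            (h1.trans_lt (ENNReal.rpow_lt_top_of_nonneg (by positivity) htop)) le_rfl))
        refine hm.trans ((mul_le_mul' h1 h2).trans_eq ?_)
        rw [← hsumexp, ENNReal.rpow_add_of_nonneg _ _ (by positivity) (by positivity)]
      exact (ENNReal.rpow_le_rpow_iff hr).1 hle
end
end

section
/- Let X and Y be pointed metric spaces and let 0 < p ≤ q ≤ s ≤ ∞. A Lipschitz map S : X → Y is Lipschitz (m^L(s;q),p)-summing if and only if there is a constant C ≥ 0 such that for all σ_1,…,σ_m ∈ ℝ, x'_1,…,x'_m, x''_1,…,x''_m ∈ X, g_1,…,g_n ∈ Y^# and m,n ∈ ℕ one has [Σ_{j=1}^m |σ_j|^q (Σ_{k=1}^n |g_k(Sx'_j) − g_k(Sx''_j)|^s)^{q/s}]^{1/q} ≤ C · ‖(σ,x',x'')|ℓ_p^{L,w}‖ · (Σ_{k=1}^n Lip(g_k)^s)^{1/s}. Moreover π^L_{(m^L(s;q),p)}(S) equals the infimum of such constants C. -/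
open MeasureTheory ENNReal NNReal

noncomputable section

/-- The `ℓ_q` norm of a finite family of extended nonnegative reals
(with the sup convention for `q = ∞`). -/
def lqNorm (q : ℝ≥0∞) {m : ℕ} (u : Fin m → ℝ≥0∞) : ℝ≥0∞ :=
  if q = ∞ then ⨆ j, u j else (∑ j, u j ^ q.toReal) ^ (1 / q.toReal)

/-- The inequality characterizing Lipschitz `(m^L(s;q),p)`-summing maps:
`[Σ_j |σ_j|^q (Σ_k |g_k(Sx'_j) - g_k(Sx''_j)|^s)^{q/s}]^{1/q}
  ≤ C ⬝ ‖(σ,x',x'')|ℓ_p^{L,w}‖ ⬝ (Σ_k Lip(g_k)^s)^{1/s}`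
for all finite sequences and all `g_1,…,g_n ∈ Y^#`. -/
def mixedCharIneq {X Y : Type*} [MetricSpace X] [MetricSpace Y] (x₀ : X) (y₀ : Y)
    (s q p : ℝ≥0∞) (S : X → Y) (C : ℝ≥0∞) : Prop :=
  ∀ (m n : ℕ) (σ : Fin m → ℝ) (x' x'' : Fin m → X) (g : Fin n → Y → ℝ),
    (∀ k, (∃ L : ℝ≥0, LipschitzWith L (g k)) ∧ g k y₀ = 0) →
    lqNorm q (fun j => ENNReal.ofReal |σ j| *
        lqNorm s (fun k => ENNReal.ofReal |g k (S (x' j)) - g k (S (x'' j))|)) ≤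
      C * weakNorm x₀ p σ x' x'' * lqNorm s (fun k => lipConst (g k))


theorem lq_eq (q : ℝ≥0∞) (hq : q ≠ 0) {m : ℕ} (u : Fin m → ℝ) :
    lqNorm q (fun j => ENNReal.ofReal |u j|) = eLpNorm u q Measure.count := by
  unfold lqNorm
  split_ifs with h
  · subst h
    rw [eLpNorm_exponent_top, eLpNormEssSup, essSup_eq_iSup (by simp)]
    simp only [Real.enorm_eq_ofReal_abs]
  · rw [eLpNorm_eq_lintegral_rpow_enorm_toReal hq h, lintegral_count, tsum_fintype]
    simp only [Real.enorm_eq_ofReal_abs]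

theorem eLp_real (p : ℝ) (hp : 0 < p) {m : ℕ} (u : Fin m → ℝ) :
    eLpNorm u (ENNReal.ofReal p) Measure.count
      = ENNReal.ofReal ((∑ j, |u j| ^ p) ^ (1 / p)) := by
  rw [← lq_eq _ (by simpa using hp)]
  unfold lqNorm
  rw [if_neg ENNReal.ofReal_ne_top, ENNReal.toReal_ofReal hp.le,
    ← ENNReal.ofReal_rpow_of_nonneg (Finset.sum_nonneg fun j _ => by positivity) (by positivity),
    ENNReal.ofReal_sum_of_nonneg (fun j _ => by positivity)]
  congr 1
  refine Finset.sum_congr rfl fun j _ => ?_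
  rw [ENNReal.ofReal_rpow_of_nonneg (abs_nonneg _) hp.le]

theorem lq_mono (q : ℝ≥0∞) {m : ℕ} {u v : Fin m → ℝ≥0∞} (h : ∀ j, u j ≤ v j) :
    lqNorm q u ≤ lqNorm q v := by
  unfold lqNorm
  split_ifs with hq
  · exact iSup_mono h
  · gcongr with j
    exact h j

theorem lq_mul (q : ℝ≥0∞) (hq : q ≠ 0) {m : ℕ} (a : ℝ≥0∞) (u : Fin m → ℝ≥0∞) :
    lqNorm q (fun j => a * u j) = a * lqNorm q u := by
  unfold lqNorm
  split_ifs with h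
  · rw [ENNReal.mul_iSup]
  · have : 0 < q.toReal := ENNReal.toReal_pos hq h
    simp_rw [ENNReal.mul_rpow_of_nonneg _ _ this.le]
    rw [← Finset.mul_sum, ENNReal.mul_rpow_of_nonneg _ _ (by positivity), ← ENNReal.rpow_mul,
      mul_one_div_cancel this.ne', ENNReal.rpow_one]

theorem lq_swap (q : ℝ≥0∞) (hq : q ≠ 0) {m n : ℕ} (u : Fin m → Fin n → ℝ≥0∞) :
    lqNorm q (fun j => lqNorm q (fun k => u j k)) = lqNorm q (fun k => lqNorm q (fun j => u j k)) := by
  unfold lqNorm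
  split_ifs with h
  · rw [iSup_comm]
  · have : 0 < q.toReal := ENNReal.toReal_pos hq h
    simp_rw [← ENNReal.rpow_mul, one_div_mul_cancel this.ne', ENNReal.rpow_one]
    rw [Finset.sum_comm]

theorem lq_ne_top (q : ℝ≥0∞) (hq : q ≠ 0) {m : ℕ} (u : Fin m → ℝ) :
    lqNorm q (fun j => ENNReal.ofReal |u j|) ≠ ∞ := by
  unfold lqNorm
  split_ifs with h
  · have : (⨆ j, ENNReal.ofReal |u j|) ≤ ∑ j, ENNReal.ofReal |u j| :=
      iSup_le fun j => Finset.single_le_sum (f := fun j => ENNReal.ofReal |u j|)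
        (fun _ _ => zero_le) (Finset.mem_univ j)
    exact ne_top_of_le_ne_top (by simp [ENNReal.sum_eq_top]) this
  · have : 0 < q.toReal := ENNReal.toReal_pos hq h
    refine ENNReal.rpow_ne_top_of_nonneg (by positivity) ?_
    rw [ENNReal.sum_ne_top]
    intro j _
    exact ENNReal.rpow_ne_top_of_nonneg this.le ENNReal.ofReal_ne_top

theorem lipConst_spec {Y : Type*} [MetricSpace Y] (g : Y → ℝ) (h : ∃ L : ℝ≥0, LipschitzWith L g) :
    ∃ L : ℝ≥0, lipConst g = L ∧ LipschitzWith L g := by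
  obtain ⟨L₀, h₀⟩ := h
  have hne : lipConst g ≠ ∞ := ne_top_of_le_ne_top (ENNReal.coe_ne_top (r := L₀)) (iInf₂_le L₀ h₀)
  refine ⟨(lipConst g).toNNReal, (ENNReal.coe_toNNReal hne).symm, ?_⟩
  intro x y
  rw [ENNReal.coe_toNNReal hne]
  by_cases hxy : edist x y = 0
  · have := h₀ x y
    rw [hxy] at this ⊢
    simpa using this
  · rw [← ENNReal.div_le_iff hxy (edist_ne_top x y)]
    refine le_iInf₂ fun K hK => ?_
    rw [ENNReal.div_le_iff hxy (edist_ne_top x y)]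
    exact hK x y

theorem weak_bound {Y : Type*} [MetricSpace Y] (y₀ : Y) (s : ℝ≥0∞) (hs : s ≠ 0) {m : ℕ}
    (a : Fin m → ℝ) (y' y'' : Fin m → Y) (g : Y → ℝ)
    (h : ∃ L : ℝ≥0, LipschitzWith L g) (h0 : g y₀ = 0) :
    lqNorm s (fun j => ENNReal.ofReal |a j * (g (y' j) - g (y'' j))|) ≤
      weakNorm y₀ s a y' y'' * lipConst g := by
  obtain ⟨L, hL, hg⟩ := lipConst_spec g h
  rw [hL]
  by_cases hz : L = 0
  · subst hz
    have : ∀ x y, g x = g y := fun x y => by simpa using hg x y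
    have h2 : ∀ j, ENNReal.ofReal |a j * (g (y' j) - g (y'' j))| = 0 * 0 := by
      intro j; rw [this (y' j) (y'' j)]; simp
    simp only [h2]
    rw [lq_mul s hs (0 : ℝ≥0∞) (fun _ : Fin m => 0)]
    simp
  · have hLp : (0 : ℝ) < L := by positivity
    have hf : (fun y => (L : ℝ)⁻¹ * g y) ∈ dualBall Y y₀ := by
      refine ⟨LipschitzWith.of_dist_le_mul fun x y => ?_, by simp [h0]⟩
      have := hg.dist_le_mul x y
      rw [Real.dist_eq] at this ⊢
      rw [← mul_sub, abs_mul, abs_of_pos (inv_pos.2 hLp), NNReal.coe_one, one_mul,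
        inv_mul_le_iff₀ hLp]
      exact this
    have h3 := le_iSup₂ (f := fun f (_ : f ∈ dualBall Y y₀) =>
      eLpNorm (fun j => a j * (f (y' j) - f (y'' j))) s Measure.count) _ hf
    rw [mul_comm]
    refine le_trans (le_of_eq ?_) (mul_le_mul_right h3 (L : ℝ≥0∞))
    rw [← lq_eq s hs, ← lq_mul s hs]
    congr 1
    ext j
    rw [← ENNReal.ofReal_coe_nnreal, ← ENNReal.ofReal_mul hLp.le]
    congr 1
    rw [← mul_sub, ← abs_of_pos hLp, ← abs_mul, abs_of_pos hLp]
    congr 1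
    field_simp

theorem conj_spec (q s : ℝ≥0∞) (hqs : q ≤ s) : HolderTriple (conjIdx q s) s q := by
  constructor
  unfold conjIdx
  rw [inv_inv, one_div, one_div]
  exact tsub_add_cancel_of_le (ENNReal.inv_le_inv.2 hqs)

theorem nec {Y : Type*} [MetricSpace Y] (y₀ : Y) (s q : ℝ≥0∞) (hq : q ≠ 0) (hqs : q ≤ s)
    {m n : ℕ} (σ : Fin m → ℝ) (y' y'' : Fin m → Y) (g : Fin n → Y → ℝ)
    (hg : ∀ k, (∃ L : ℝ≥0, LipschitzWith L (g k)) ∧ g k y₀ = 0)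
    (τ : Fin m → ℝ) (hτ : ∀ j, τ j ≠ 0) :
    lqNorm q (fun j => ENNReal.ofReal |σ j| *
        lqNorm s (fun k => ENNReal.ofReal |g k (y' j) - g k (y'' j)|)) ≤
      eLpNorm τ (conjIdx q s) Measure.count * weakNorm y₀ s (fun j => σ j / τ j) y' y''
        * lqNorm s (fun k => lipConst (g k)) := by
  have hs : s ≠ 0 := fun h => hq (by simpa [h] using hqs)
  have := conj_spec q s hqs
  set N : Fin m → ℝ := fun j =>
    (lqNorm s (fun k => ENNReal.ofReal |g k (y' j) - g k (y'' j)|)).toReal with hN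
  have hN' : ∀ j, lqNorm s (fun k => ENNReal.ofReal |g k (y' j) - g k (y'' j)|)
      = ENNReal.ofReal |N j| := by
    intro j
    rw [abs_of_nonneg ENNReal.toReal_nonneg, ENNReal.ofReal_toReal (lq_ne_top s hs _)]
  have e1 : (fun j => ENNReal.ofReal |σ j| *
        lqNorm s (fun k => ENNReal.ofReal |g k (y' j) - g k (y'' j)|))
      = fun j => ENNReal.ofReal |(τ • fun j => σ j / τ j * N j) j| := by
    ext j
    rw [hN', ← ENNReal.ofReal_mul (abs_nonneg _), ← abs_mul]
    congr 2
    simp only [Pi.smul_apply', smul_eq_mul]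
    field_simp [hτ j]
  rw [e1, lq_eq q hq, mul_assoc]
  refine (eLpNorm_smul_le_mul_eLpNorm (p := conjIdx q s) (q := s)
    (measurable_of_finite _).aestronglyMeasurable
    (measurable_of_finite _).aestronglyMeasurable).trans ?_
  gcongr
  rw [← lq_eq s hs, ← lq_mul s hs]
  have e2 : (fun j => ENNReal.ofReal |σ j / τ j * N j|) = fun j => lqNorm s (fun k =>
      ENNReal.ofReal |σ j / τ j * (g k (y' j) - g k (y'' j))|) := by
    ext j
    simp_rw [abs_mul, ENNReal.ofReal_mul (abs_nonneg _)]
    rw [lq_mul s hs, hN']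
  rw [e2, lq_swap s hs]
  exact lq_mono s fun k => weak_bound y₀ s hs _ y' y'' (g k) (hg k).1 (hg k).2


theorem key {m : ℕ} (V : Set (Fin m → ℝ)) (hne : V.Nonempty) (hb : Bornology.IsBounded V)
    (hnn : ∀ v ∈ V, ∀ j, 0 ≤ v j) (θ : ℝ) (h0 : 0 < θ) (h1 : θ < 1) (M : ℝ)
    (hM : ∀ b ∈ convexHull ℝ V, ∑ j, b j ^ θ ≤ M) (δ : ℝ) (hδ : 0 < δ) :
    ∃ c : Fin m → ℝ, (∀ j, 0 < c j) ∧ ∑ j, c j ^ θ ≤ M + m * δ ^ θ ∧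
      ∀ v ∈ V, ∑ j, c j ^ (θ - 1) * v j ≤ ∑ j, c j ^ θ := by
  have hpos : closure (convexHull ℝ V) ⊆ {b | ∀ j, 0 ≤ b j} := by
    refine closure_minimal (convexHull_min hnn ?_) ?_
    · intro x hx y hy a b ha hb _ j
      have := hx j
      have := hy j
      simp only [Pi.add_apply, Pi.smul_apply, smul_eq_mul]
      positivity
    · simp only [Set.setOf_forall]
      exact isClosed_iInter fun j => isClosed_le continuous_const (continuous_apply j)
  have hcomp : IsCompact (closure (convexHull ℝ V)) :=
    Metric.isCompact_of_isClosed_isBounded isClosed_closure (isBounded_convexHull.2 hb).closure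
  have hcont : Continuous (fun b : Fin m → ℝ => ∑ j, (|b j| + δ) ^ θ) := by
    refine continuous_finsetSum _ fun j _ => ?_
    exact ((continuous_apply j).abs.add continuous_const).rpow_const fun _ => Or.inr h0.le
  have hcontM : Continuous (fun b : Fin m → ℝ => ∑ j, (b j) ^ θ) := by
    refine continuous_finsetSum _ fun j _ => ?_
    exact (continuous_apply j).rpow_const fun _ => Or.inr h0.le
  have hMc : closure (convexHull ℝ V) ⊆ {b | ∑ j, b j ^ θ ≤ M} :=
    closure_minimal hM (isClosed_le hcontM continuous_const)
  obtain ⟨b, hbK, hmax⟩ := hcomp.exists_isMaxOn (hne.convexHull.closure) hcont.continuousOn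
  have hbp : ∀ j, 0 ≤ b j := hpos hbK
  have hmax' : IsMaxOn (fun b : Fin m → ℝ => ∑ j, (b j + δ) ^ θ) (closure (convexHull ℝ V)) b := by
    intro x hx
    have := hmax hx
    simp only [Set.mem_setOf_eq] at this ⊢
    have hxp : ∀ j, 0 ≤ x j := hpos hx
    simpa only [abs_of_nonneg (hbp _), abs_of_nonneg (hxp _)] using this
  have hc : ∀ j, 0 < b j + δ := fun j => add_pos_of_nonneg_of_pos (hbp j) hδ
  refine ⟨fun j => b j + δ, hc, ?_, ?_⟩
  · calc ∑ j, (b j + δ) ^ θ ≤ ∑ j, (b j ^ θ + δ ^ θ) :=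
          Finset.sum_le_sum fun j _ => Real.rpow_add_le_add_rpow (hbp j) hδ.le h0.le h1.le
      _ = ∑ j, b j ^ θ + m * δ ^ θ := by simp [Finset.sum_add_distrib]
      _ ≤ _ := by gcongr; exact hMc hbK
  · intro v hv
    have hd : HasFDerivAt (fun b : Fin m → ℝ => ∑ j, (b j + δ) ^ θ)
        (∑ j, (θ * (b j + δ) ^ (θ - 1)) • (ContinuousLinearMap.proj j : (Fin m → ℝ) →L[ℝ] ℝ)) b := by
      refine HasFDerivAt.fun_sum fun j _ => ?_
      exact ((hasFDerivAt_apply j b).add_const δ).rpow_const (Or.inl (hc j).ne')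
    have hvK : v ∈ closure (convexHull ℝ V) := subset_closure (subset_convexHull ℝ V hv)
    have hseg := (convex_convexHull ℝ V).closure.segment_subset hbK hvK
    have := hmax'.localize.hasFDerivWithinAt_nonpos hd.hasFDerivWithinAt
      (sub_mem_posTangentConeAt_of_segment_subset hseg)
    simp only [ContinuousLinearMap.sum_apply, ContinuousLinearMap.smul_apply,
      ContinuousLinearMap.proj_apply, Pi.sub_apply, smul_eq_mul, mul_assoc] at this
    rw [← Finset.mul_sum] at this
    have h2 : ∑ j, (b j + δ) ^ (θ - 1) * (v j - b j) ≤ 0 := by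
      by_contra hcon
      push Not at hcon
      exact absurd this (not_le.2 (mul_pos h0 hcon))
    calc ∑ j, (b j + δ) ^ (θ - 1) * v j
        = ∑ j, (b j + δ) ^ (θ - 1) * (v j - b j) + ∑ j, (b j + δ) ^ (θ - 1) * b j := by
          rw [← Finset.sum_add_distrib]; exact Finset.sum_congr rfl fun j _ => by ring
      _ ≤ ∑ j, (b j + δ) ^ (θ - 1) * b j := by linarith
      _ ≤ ∑ j, (b j + δ) ^ (θ - 1) * (b j + δ) := by
          gcongr with j
          · exact Real.rpow_nonneg (hc j).le _
          · linarith
      _ = _ := Finset.sum_congr rfl fun j _ => by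
          rw [Real.rpow_sub_one (hc j).ne']; exact div_mul_cancel₀ _ (hc j).ne'

theorem zero_mem_ball (Y : Type*) [MetricSpace Y] (y₀ : Y) : (fun _ => (0:ℝ)) ∈ dualBall Y y₀ :=
  ⟨LipschitzWith.const' 0, rfl⟩

theorem ball_le {Y : Type*} [MetricSpace Y] {y₀ : Y} {f : Y → ℝ} (hf : f ∈ dualBall Y y₀) (x y : Y) :
    |f x - f y| ≤ dist x y := by
  have := hf.1.dist_le_mul x y
  rwa [NNReal.coe_one, one_mul, Real.dist_eq] at this

theorem lipConst_ball {Y : Type*} [MetricSpace Y] {y₀ : Y} {f : Y → ℝ} (hf : f ∈ dualBall Y y₀) :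
    lipConst f ≤ 1 := iInf₂_le_of_le 1 hf.1 (by simp)

theorem lipConst_ball_mul {Y : Type*} [MetricSpace Y] {y₀ : Y} {f : Y → ℝ}
    (hf : f ∈ dualBall Y y₀) (a : ℝ) (ha : 0 ≤ a) :
    LipschitzWith a.toNNReal (fun y => a * f y) := by
  refine LipschitzWith.of_dist_le_mul fun x y => ?_
  rw [Real.dist_eq, ← mul_sub, abs_mul, abs_of_nonneg ha, Real.coe_toNNReal _ ha]
  exact mul_le_mul_of_nonneg_left (ball_le hf x y) ha

theorem suffC {Y : Type*} [MetricSpace Y] (y₀ : Y) (s q : ℝ) (hq : 0 < q) (hqs : q < s)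
    {m : ℕ} (σ : Fin m → ℝ) (y' y'' : Fin m → Y) (D : ℝ) (hD : 0 ≤ D)
    (H : ∀ (n : ℕ) (g : Fin n → Y → ℝ),
      (∀ k, (∃ L : ℝ≥0, LipschitzWith L (g k)) ∧ g k y₀ = 0) →
      lqNorm (ENNReal.ofReal q) (fun j => ENNReal.ofReal |σ j| *
        lqNorm (ENNReal.ofReal s) (fun k => ENNReal.ofReal |g k (y' j) - g k (y'' j)|)) ≤
      ENNReal.ofReal D * lqNorm (ENNReal.ofReal s) (fun k => lipConst (g k))) :
    mixedNorm y₀ (ENNReal.ofReal s) (ENNReal.ofReal q) σ y' y'' ≤ ENNReal.ofReal D := by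
  have hs : 0 < s := hq.trans hqs
  have hs' : ENNReal.ofReal s ≠ 0 := by simpa using hs
  have hq' : ENNReal.ofReal q ≠ 0 := by simpa using hq
  set θ := q / s with hθ
  have h0 : 0 < θ := by positivity
  have h1 : θ < 1 := (div_lt_one hs).2 hqs
  set F : (Y → ℝ) → Fin m → ℝ := fun f j => |σ j * (f (y' j) - f (y'' j))| ^ s with hF
  set V : Set (Fin m → ℝ) := F '' dualBall Y y₀ with hV
  have hnn : ∀ v ∈ V, ∀ j, 0 ≤ v j := by
    rintro _ ⟨f, -, rfl⟩ j
    simp only [hF]; positivity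
  have hne : V.Nonempty := ⟨_, _, zero_mem_ball Y y₀, rfl⟩
  have hb : Bornology.IsBounded V := by
    refine (Metric.isBounded_Icc (0 : Fin m → ℝ)
      (fun j => (|σ j| * dist (y' j) (y'' j)) ^ s)).subset ?_
    rintro _ ⟨f, hf, rfl⟩
    refine ⟨fun j => by simp only [hF, Pi.zero_apply]; positivity, fun j => ?_⟩
    simp only [hF]
    rw [abs_mul]
    gcongr
    exact ball_le hf _ _
  have hM : ∀ b ∈ convexHull ℝ V, ∑ j, b j ^ θ ≤ D ^ q := by
    intro b hb
    rw [mem_convexHull_iff_exists_fintype] at hb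
    obtain ⟨ι, _, w, z, hw0, hw1, hz, rfl⟩ := hb
    choose f hf hfz using hz
    let e := (Fintype.equivFin ι).symm
    let g : Fin (Fintype.card ι) → Y → ℝ := fun k y => w (e k) ^ (1 / s) * f (e k) y
    have hw0' : ∀ i, 0 ≤ w i ^ (1 / s) := fun i => Real.rpow_nonneg (hw0 i) _
    have hlip : ∀ k, LipschitzWith (w (e k) ^ (1 / s)).toNNReal (g k) :=
      fun k => lipConst_ball_mul (hf _) _ (hw0' _)
    have h := H _ g (fun k => ⟨⟨_, hlip k⟩, by simp [g, (hf (e k)).2]⟩)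
    have hR : lqNorm (ENNReal.ofReal s) (fun k => lipConst (g k)) ≤ 1 := by
      have : lqNorm (ENNReal.ofReal s) (fun k => lipConst (g k)) ≤
          lqNorm (ENNReal.ofReal s) (fun k => ENNReal.ofReal |w (e k) ^ (1 / s)|) := by
        refine lq_mono _ fun k => ?_
        rw [abs_of_nonneg (hw0' _)]
        exact iInf₂_le_of_le (ι := ℝ≥0) _ (hlip k) le_rfl
      refine this.trans (le_of_eq ?_)
      rw [lq_eq _ hs', eLp_real s hs]
      have : ∑ k, |w (e k) ^ (1 / s)| ^ s = 1 := by
        refine Eq.trans ?_ hw1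
        rw [← e.sum_comp]
        refine Finset.sum_congr rfl fun k _ => ?_
        rw [abs_of_nonneg (hw0' _), ← Real.rpow_mul (hw0 _), one_div_mul_cancel hs.ne', Real.rpow_one]
      rw [this]; simp
    have hL : ∀ j, ENNReal.ofReal |σ j| *
        lqNorm (ENNReal.ofReal s) (fun k => ENNReal.ofReal |g k (y' j) - g k (y'' j)|)
        = ENNReal.ofReal |((∑ i, w i • z i) j) ^ (1 / s)| := by
      intro j
      rw [← lq_mul _ hs']
      simp_rw [← ENNReal.ofReal_mul (abs_nonneg _), ← abs_mul]
      rw [lq_eq _ hs' (fun k => σ j * (g k (y' j) - g k (y'' j))), eLp_real s hs]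
      congr 1
      have hh : ∑ k, |σ j * (g k (y' j) - g k (y'' j))| ^ s = (∑ i, w i • z i) j := by
        rw [Finset.sum_apply, ← e.sum_comp]
        refine Finset.sum_congr rfl fun k _ => ?_
        simp only [Pi.smul_apply, smul_eq_mul, ← hfz, hF, g]
        rw [← mul_sub, mul_left_comm, abs_mul, abs_of_nonneg (hw0' _),
          Real.mul_rpow (hw0' _) (abs_nonneg _), ← Real.rpow_mul (hw0 _),
          one_div_mul_cancel hs.ne', Real.rpow_one]
      rw [hh, abs_of_nonneg]
      rw [← hh]
      positivity
    have hbn : ∀ j, 0 ≤ (∑ i, w i • z i) j := by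
      intro j
      rw [Finset.sum_apply]
      refine Finset.sum_nonneg fun i _ => ?_
      have := hnn (z i) ⟨_, hf i, hfz i⟩ j
      have := hw0 i
      simp only [Pi.smul_apply, smul_eq_mul]
      positivity
    simp_rw [hL] at h
    rw [lq_eq _ hq' (fun j => ((∑ i, w i • z i) j) ^ (1 / s)), eLp_real q hq] at h
    have h2 := h.trans (mul_le_of_le_one_right' hR)
    rw [ENNReal.ofReal_le_ofReal_iff hD] at h2
    have h3 : ∑ j, |((∑ i, w i • z i) j) ^ (1 / s)| ^ q = ∑ j, ((∑ i, w i • z i) j) ^ θ := by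
      refine Finset.sum_congr rfl fun j _ => ?_
      rw [abs_of_nonneg (Real.rpow_nonneg (hbn j) _), ← Real.rpow_mul (hbn j), hθ]
      congr 1; ring
    rw [h3] at h2
    have h4 := Real.rpow_le_rpow (Real.rpow_nonneg
      (Finset.sum_nonneg fun j _ => Real.rpow_nonneg (hbn j) _) _) h2 hq.le
    rwa [← Real.rpow_mul (Finset.sum_nonneg fun j _ => Real.rpow_nonneg (hbn j) _),
      one_div_mul_cancel hq.ne', Real.rpow_one] at h4
  have main : ∀ δ : ℝ, 0 < δ → mixedNorm y₀ (ENNReal.ofReal s) (ENNReal.ofReal q) σ y' y'' ≤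
      ENNReal.ofReal ((D ^ q + m * δ ^ θ) ^ (1 / q)) := by
    intro δ hδ
    obtain ⟨c, hc, hcM, hcV⟩ := key V hne hb hnn θ h0 h1 _ hM δ hδ
    set N := ∑ j, c j ^ θ with hN
    have hNn : 0 ≤ N := Finset.sum_nonneg fun j _ => Real.rpow_nonneg (hc j).le _
    set t : ℝ := q * s / (s - q) with ht
    have hsq : 0 < s - q := sub_pos.2 hqs
    have htp : 0 < t := by positivity
    have hconj : conjIdx (ENNReal.ofReal q) (ENNReal.ofReal s) = ENNReal.ofReal t := by
      unfold conjIdx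
      rw [one_div, one_div, ← ENNReal.ofReal_inv_of_pos hq, ← ENNReal.ofReal_inv_of_pos hs,
        ← ENNReal.ofReal_sub _ (by positivity), ← ENNReal.ofReal_inv_of_pos]
      · congr 1
        rw [ht]; field_simp
      · rw [sub_pos]; exact inv_strictAnti₀ hq hqs
    have hτ : ∀ j, 0 < c j ^ ((1 - θ) / s) := fun j => Real.rpow_pos_of_pos (hc j) _
    refine (iInf₂_le (fun j => c j ^ ((1 - θ) / s)) (fun j => (hτ j).ne')).trans ?_
    have e1 : eLpNorm (fun j => c j ^ ((1 - θ) / s))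
        (conjIdx (ENNReal.ofReal q) (ENNReal.ofReal s)) Measure.count
        = ENNReal.ofReal (N ^ (1 / t)) := by
      rw [hconj, eLp_real t htp]
      congr 2
      refine Finset.sum_congr rfl fun j _ => ?_
      rw [abs_of_pos (hτ j), ← Real.rpow_mul (hc j).le]
      congr 1
      rw [ht, hθ]; field_simp
    have e2 : weakNorm y₀ (ENNReal.ofReal s) (fun j => σ j / c j ^ ((1 - θ) / s)) y' y''
        ≤ ENNReal.ofReal (N ^ (1 / s)) := by
      refine iSup₂_le fun f hf => ?_
      rw [eLp_real s hs]
      refine ENNReal.ofReal_le_ofReal (Real.rpow_le_rpow (by positivity) ?_ (by positivity))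
      refine le_trans (le_of_eq ?_) (hcV _ ⟨f, hf, rfl⟩)
      refine Finset.sum_congr rfl fun j _ => ?_
      simp only [hF]
      rw [div_mul_eq_mul_div, abs_div, abs_of_pos (hτ j),
        Real.div_rpow (abs_nonneg _) (hτ j).le, ← Real.rpow_mul (hc j).le,
        div_mul_cancel₀ _ hs.ne', ← neg_sub 1 θ, Real.rpow_neg (hc j).le]
      rw [div_eq_inv_mul]
    rw [e1]
    refine (mul_le_mul_right e2 _).trans ?_
    rw [← ENNReal.ofReal_mul (Real.rpow_nonneg hNn _)]
    refine ENNReal.ofReal_le_ofReal ?_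
    have : 1 / t + 1 / s = 1 / q := by rw [ht]; field_simp; ring
    rw [← Real.rpow_add_of_nonneg hNn (by positivity) (by positivity), this]
    exact Real.rpow_le_rpow hNn hcM (by positivity)
  have hcont : Continuous (fun δ : ℝ => ENNReal.ofReal ((D ^ q + m * δ ^ θ) ^ (1 / q))) := by
    refine ENNReal.continuous_ofReal.comp (Continuous.rpow_const ?_ fun _ => Or.inr (by positivity))
    exact continuous_const.add (continuous_const.mul
      (continuous_id.rpow_const fun _ => Or.inr h0.le))
  have hlim := (hcont.tendsto 0).mono_left (nhdsWithin_le_nhds (s := Set.Ioi 0))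
  have := ge_of_tendsto hlim (by filter_upwards [self_mem_nhdsWithin] with δ hδ using main δ hδ)
  refine this.trans (le_of_eq ?_)
  rw [Real.zero_rpow h0.ne', mul_zero, add_zero, ← Real.rpow_mul hD, mul_one_div_cancel hq.ne',
    Real.rpow_one]

theorem suffB {Y : Type*} [MetricSpace Y] (y₀ : Y) (q : ℝ) (hq : 0 < q)
    {m : ℕ} (σ : Fin m → ℝ) (y' y'' : Fin m → Y) (D : ℝ≥0∞)
    (H : ∀ (n : ℕ) (g : Fin n → Y → ℝ),
      (∀ k, (∃ L : ℝ≥0, LipschitzWith L (g k)) ∧ g k y₀ = 0) →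
      lqNorm (ENNReal.ofReal q) (fun j => ENNReal.ofReal |σ j| *
        lqNorm ∞ (fun k => ENNReal.ofReal |g k (y' j) - g k (y'' j)|)) ≤
      D * lqNorm ∞ (fun k => lipConst (g k))) :
    mixedNorm y₀ ∞ (ENNReal.ofReal q) σ y' y'' ≤ D := by
  have hq' : ENNReal.ofReal q ≠ 0 := by simpa using hq
  have hball : ∀ k, (fun y => dist y (y'' k) - dist y₀ (y'' k)) ∈ dualBall Y y₀ := by
    intro k
    refine ⟨LipschitzWith.of_dist_le_mul fun x y => ?_, by simp⟩
    rw [Real.dist_eq, NNReal.coe_one, one_mul]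
    simpa using abs_dist_sub_le x y (y'' k)
  have h := H m (fun k y => dist y (y'' k) - dist y₀ (y'' k))
    (fun k => ⟨⟨1, (hball k).1⟩, (hball k).2⟩)
  have hR : lqNorm ∞ (fun k => lipConst (fun y => dist y (y'' k) - dist y₀ (y'' k))) ≤ 1 := by
    unfold lqNorm
    rw [if_pos rfl]
    exact iSup_le fun k => lipConst_ball (hball k)
  have h1 : ENNReal.ofReal ((∑ j, |(|σ j| * dist (y' j) (y'' j))| ^ q) ^ (1 / q)) ≤ D := by
    rw [← eLp_real q hq, ← lq_eq _ hq']
    refine le_trans (lq_mono _ fun j => ?_) (h.trans (mul_le_of_le_one_right' hR))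
    rw [abs_mul, abs_abs, ENNReal.ofReal_mul (abs_nonneg _)]
    gcongr
    unfold lqNorm
    rw [if_pos rfl]
    refine le_iSup_of_le j (le_of_eq ?_)
    simp
  have main : ∀ δ : ℝ, 0 < δ → mixedNorm y₀ ∞ (ENNReal.ofReal q) σ y' y'' ≤
      ENNReal.ofReal ((∑ j, |(|σ j| * dist (y' j) (y'' j) + δ)| ^ q) ^ (1 / q)) := by
    intro δ hδ
    have hτ : ∀ j, 0 < |σ j| * dist (y' j) (y'' j) + δ := fun j => by positivity
    refine (iInf₂_le (fun j => |σ j| * dist (y' j) (y'' j) + δ) (fun j => (hτ j).ne')).trans ?_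
    have hconj : conjIdx (ENNReal.ofReal q) ∞ = ENNReal.ofReal q := by simp [conjIdx]
    rw [hconj, eLp_real q hq]
    refine mul_le_of_le_one_right' ?_
    refine iSup₂_le fun f hf => ?_
    rw [← lq_eq _ ENNReal.top_ne_zero]
    unfold lqNorm
    rw [if_pos rfl]
    refine iSup_le fun j => ?_
    rw [ENNReal.ofReal_le_one, div_mul_eq_mul_div, abs_div, abs_of_pos (hτ j), div_le_one (hτ j),
      abs_mul]
    have := mul_le_mul_of_nonneg_left (ball_le hf (y' j) (y'' j)) (abs_nonneg (σ j))
    linarith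
  have hcont : Continuous (fun δ : ℝ =>
      ENNReal.ofReal ((∑ j, |(|σ j| * dist (y' j) (y'' j) + δ)| ^ q) ^ (1 / q))) := by
    refine ENNReal.continuous_ofReal.comp (Continuous.rpow_const ?_ fun _ => Or.inr (by positivity))
    refine continuous_finsetSum _ fun j _ => ?_
    exact (continuous_const.add continuous_id).abs.rpow_const fun _ => Or.inr hq.le
  have hlim := (hcont.tendsto 0).mono_left (nhdsWithin_le_nhds (s := Set.Ioi 0))
  have := ge_of_tendsto hlim (by filter_upwards [self_mem_nhdsWithin] with δ hδ using main δ hδ)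
  refine this.trans (le_trans (le_of_eq ?_) h1)
  simp only [add_zero]

theorem suffA {Y : Type*} [MetricSpace Y] (y₀ : Y) (q : ℝ≥0∞) (hq : q ≠ 0)
    {m : ℕ} (σ : Fin m → ℝ) (y' y'' : Fin m → Y) (D : ℝ≥0∞)
    (H : ∀ (n : ℕ) (g : Fin n → Y → ℝ),
      (∀ k, (∃ L : ℝ≥0, LipschitzWith L (g k)) ∧ g k y₀ = 0) →
      lqNorm q (fun j => ENNReal.ofReal |σ j| *
        lqNorm q (fun k => ENNReal.ofReal |g k (y' j) - g k (y'' j)|)) ≤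
      D * lqNorm q (fun k => lipConst (g k))) :
    mixedNorm y₀ q q σ y' y'' ≤ D := by
  have hone : ∀ u : Fin 1 → ℝ≥0∞, lqNorm q u = u 0 := by
    intro u
    unfold lqNorm
    split_ifs with h
    · simp
    · have : 0 < q.toReal := ENNReal.toReal_pos hq h
      rw [Fin.sum_univ_one, ← ENNReal.rpow_mul, mul_one_div_cancel this.ne', ENNReal.rpow_one]
  refine (iInf₂_le (fun _ => 1) (fun _ => one_ne_zero)).trans ?_
  have e1 : eLpNorm (fun _ : Fin m => (1:ℝ)) (conjIdx q q) Measure.count ≤ 1 := by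
    have : conjIdx q q = ∞ := by simp [conjIdx]
    rw [this, ← lq_eq _ ENNReal.top_ne_zero]
    unfold lqNorm
    rw [if_pos rfl]
    exact iSup_le fun j => by simp
  refine (mul_le_of_le_one_left' e1).trans ?_
  refine iSup₂_le fun f hf => ?_
  have h := H 1 (fun _ => f) (fun _ => ⟨⟨1, hf.1⟩, hf.2⟩)
  simp only [hone] at h
  refine le_trans (le_of_eq ?_) (h.trans (mul_le_of_le_one_right' (lipConst_ball hf)))
  rw [← lq_eq _ hq]
  congr 1
  ext j
  simp only [div_one]
  rw [abs_mul, ENNReal.ofReal_mul (abs_nonneg _)]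

theorem equivD {Y : Type*} [MetricSpace Y] (y₀ : Y) (s q : ℝ≥0∞) (hq : q ≠ 0) (hqs : q ≤ s)
    {m : ℕ} (σ : Fin m → ℝ) (y' y'' : Fin m → Y) (D : ℝ≥0∞) :
    mixedNorm y₀ s q σ y' y'' ≤ D ↔ ∀ (n : ℕ) (g : Fin n → Y → ℝ),
      (∀ k, (∃ L : ℝ≥0, LipschitzWith L (g k)) ∧ g k y₀ = 0) →
      lqNorm q (fun j => ENNReal.ofReal |σ j| *
        lqNorm s (fun k => ENNReal.ofReal |g k (y' j) - g k (y'' j)|)) ≤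
      D * lqNorm s (fun k => lipConst (g k)) := by
  have hs : s ≠ 0 := fun h => hq (by simpa [h] using hqs)
  constructor
  · intro h n g hg
    by_cases hz : lqNorm s (fun k => lipConst (g k)) = 0
    · have := nec y₀ s q hq hqs σ y' y'' g hg (fun _ => 1) (fun _ => one_ne_zero)
      rw [hz, mul_zero] at this ⊢
      exact this
    have hfin : lqNorm s (fun k => lipConst (g k)) ≠ ∞ := by
      choose L hL _ using fun k => lipConst_spec (g k) (hg k).1
      simp only [hL]
      have := lq_ne_top s hs (fun k => (L k : ℝ))
      simpa using this
    rw [← ENNReal.div_le_iff hz hfin]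
    refine le_trans (le_iInf₂ fun τ hτ => ?_) h
    rw [ENNReal.div_le_iff hz hfin]
    exact nec y₀ s q hq hqs σ y' y'' g hg τ hτ
  · intro H
    by_cases hDt : D = ∞
    · rw [hDt]; exact le_top
    rcases hqs.eq_or_lt with rfl | hlt
    · exact suffA y₀ q hq σ y' y'' D H
    · have hqt : q ≠ ∞ := hlt.ne_top
      have hqp : 0 < q.toReal := ENNReal.toReal_pos hq hqt
      rw [← ENNReal.ofReal_toReal hqt] at H ⊢
      by_cases hst : s = ∞
      · subst hst
        exact suffB y₀ _ hqp σ y' y'' D H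
      · have hsq : q.toReal < s.toReal := (ENNReal.toReal_lt_toReal hqt hst).2 hlt
        rw [← ENNReal.ofReal_toReal hst, ← ENNReal.ofReal_toReal hDt] at H ⊢
        exact suffC y₀ _ _ hqp hsq σ y' y'' _ ENNReal.toReal_nonneg H

theorem equivC {X Y : Type*} [MetricSpace X] [MetricSpace Y] (x₀ : X) (y₀ : Y)
    (s q p : ℝ≥0∞) (hq : q ≠ 0) (hqs : q ≤ s) (S : X → Y) (C : ℝ≥0∞) :
    (∀ (m : ℕ) (σ : Fin m → ℝ) (x' x'' : Fin m → X),
      mixedNorm y₀ s q σ (S ∘ x') (S ∘ x'') ≤ C * weakNorm x₀ p σ x' x'') ↔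
    mixedCharIneq x₀ y₀ s q p S C := by
  constructor
  · intro h m n σ x' x'' g hg
    exact (equivD y₀ s q hq hqs σ _ _ _).1 (h m σ x' x'') n g hg
  · intro h m σ x' x''
    exact (equivD y₀ s q hq hqs σ _ _ _).2 fun n g hg => h m n σ x' x'' g hg

/-- for `0 < p ≤ q ≤ s ≤ ∞`, a Lipschitz map `S` is Lipschitz
`(m^L(s;q),p)`-summing iff the characterizing inequality holds for some constant `C ≥ 0`;
moreover `π^L_{(m^L(s;q),p)}(S)` is the least such constant. -/
theorem stmt1 {X Y : Type*} [MetricSpace X] [MetricSpace Y] (x₀ : X) (y₀ : Y)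
    (s q p : ℝ≥0∞) (hp : 0 < p) (hpq : p ≤ q) (hqs : q ≤ s)
    (S : X → Y) (K : ℝ≥0) (hS : LipschitzWith K S) :
    (LipMixedP x₀ y₀ s q p S ↔ ∃ C : ℝ≥0, mixedCharIneq x₀ y₀ s q p S (C : ℝ≥0∞)) ∧
    lipMixedPNorm x₀ y₀ s q p S = sInf {C : ℝ≥0∞ | mixedCharIneq x₀ y₀ s q p S C} := by
  have hq : q ≠ 0 := (hp.trans_le hpq).ne'
  refine ⟨exists_congr fun C => equivC x₀ y₀ s q p hq hqs S C, ?_⟩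
  unfold lipMixedPNorm
  congr 1
  ext C
  exact equivC x₀ y₀ s q p hq hqs S C
end
end

section
/- Let X and Y be pointed metric spaces, 0 < q ≤ s ≤ ∞, 0 < p ≤ q, and let T : X → Y be a Lipschitz map. Suppose there is a constant C ≥ 0 such that for every Borel probability measure ν on B_{Y^#} there exists a Borel probability measure μ on B_{X^#} with (∫_{B_{Y^#}} |g(Ta) − g(Tb)|^s dν(g))^{1/s} ≤ C · (∫_{B_{X^#}} |f(a) − f(b)|^p dμ(f))^{1/p} for all a, b ∈ X. Then T is Lipschitz (m^L(s;q),p)-summing and π^L_{(m^L(s;q),p)}(T) ≤ C. -/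
open MeasureTheory ENNReal NNReal

noncomputable section

lemma measDual {X : Type*} [MetricSpace X] {x₀ : X} (a b : X) :
    Measurable (fun f : DualBallT X x₀ => f.toFun a - f.toFun b) := by
  have : BorelSpace (DualBallT X x₀) := ⟨rfl⟩
  have hc : Continuous (fun f : DualBallT X x₀ => f.toFun) := continuous_induced_dom
  have : Continuous (fun f : DualBallT X x₀ => f.toFun a - f.toFun b) :=
    ((continuous_apply a).comp hc).sub ((continuous_apply b).comp hc)
  exact this.measurable

lemma core {m : ℕ} (S : Set (Fin m → ℝ)) (θ : ℝ) (h0 : 0 < θ)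
    (hconv : Convex ℝ S) (hcomp : IsCompact S) (hne : S.Nonempty)
    (hnn : ∀ v ∈ S, ∀ j, 0 ≤ v j) (δ : ℝ) (hδ : 0 < δ) :
    ∃ u ∈ S, ∀ v ∈ S, ∑ j, (u j + δ) ^ (θ - 1) * v j ≤ ∑ j, (u j + δ) ^ θ := by
  have hcont : ContinuousOn (fun v : Fin m → ℝ => ∑ j, (v j + δ) ^ θ) S := by
    refine continuousOn_finsetSum _ fun j _ => ?_
    refine ContinuousOn.rpow_const (by fun_prop) fun v hv => Or.inr h0.le
  obtain ⟨u, hu, hmax⟩ := hcomp.exists_isMaxOn hne hcont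
  refine ⟨u, hu, fun v hv => ?_⟩
  have hpos : ∀ j, 0 < u j + δ := fun j => by linarith [hnn u hu j]
  have hd : HasFDerivAt (fun v : Fin m → ℝ => ∑ j, (v j + δ) ^ θ)
      (∑ j, (θ * (u j + δ) ^ (θ - 1)) • (ContinuousLinearMap.proj j : (Fin m → ℝ) →L[ℝ] ℝ)) u := by
    refine HasFDerivAt.fun_sum fun j _ => ?_
    exact ((hasFDerivAt_apply j u).add_const δ).rpow_const (Or.inl (hpos j).ne')
  have hle := hmax.localize.hasFDerivWithinAt_nonpos hd.hasFDerivWithinAt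
    (y := v - u) (mem_posTangentConeAt_of_segment_subset
      (by simpa using hconv.segment_subset hu hv))
  simp only [sum_apply, smul_apply,
    ContinuousLinearMap.proj_apply, Pi.sub_apply, smul_eq_mul, mul_assoc] at hle
  rw [← Finset.mul_sum] at hle
  have h2 : ∑ j, (u j + δ) ^ (θ - 1) * (v j - u j) ≤ 0 := by
    by_contra hcon
    push Not at hcon
    exact absurd hle (not_le.mpr (mul_pos h0 hcon))
  have h3 : ∀ j, (u j + δ) ^ (θ - 1) * u j ≤ (u j + δ) ^ θ := fun j => by
    have : (u j + δ) ^ θ = (u j + δ) ^ (θ - 1) * (u j + δ) := by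
      rw [Real.rpow_sub_one (hpos j).ne']; field_simp [(hpos j).ne']
    rw [this]
    exact mul_le_mul_of_nonneg_left (by linarith) (Real.rpow_nonneg (hpos j).le _)
  have h4 := Finset.sum_le_sum fun j (_ : j ∈ Finset.univ) => h3 j
  simp only [mul_sub, Finset.sum_sub_distrib] at h2
  linarith

lemma eLp_count {m : ℕ} (f : Fin m → ℝ) (p : ℝ≥0∞) (h0 : p ≠ 0) (ht : p ≠ ∞) :
    eLpNorm f p Measure.count = (∑ j, ‖f j‖ₑ ^ p.toReal) ^ (1 / p.toReal) := by
  rw [eLpNorm_eq_lintegral_rpow_enorm_toReal h0 ht, lintegral_count, tsum_fintype]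

lemma eLp_count_real {m : ℕ} (f : Fin m → ℝ) (p : ℝ≥0∞) (h0 : p ≠ 0) (ht : p ≠ ∞) :
    eLpNorm f p Measure.count = ENNReal.ofReal ((∑ j, |f j| ^ p.toReal) ^ (1 / p.toReal)) := by
  have hp : 0 < p.toReal := ENNReal.toReal_pos h0 ht
  rw [eLp_count f p h0 ht, ← ENNReal.ofReal_rpow_of_nonneg
    (Finset.sum_nonneg fun j _ => Real.rpow_nonneg (abs_nonneg _) _) (by positivity),
    ENNReal.ofReal_sum_of_nonneg (fun j _ => Real.rpow_nonneg (abs_nonneg _) _)]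
  congr 1
  refine Finset.sum_congr rfl fun j _ => ?_
  rw [← ENNReal.ofReal_rpow_of_nonneg (abs_nonneg _) hp.le, Real.enorm_eq_ofReal_abs]

lemma weak_sum_le {X : Type*} [MetricSpace X] (x₀ : X) (p : ℝ≥0∞) (h0 : p ≠ 0) (ht : p ≠ ∞)
    {m : ℕ} (σ : Fin m → ℝ) (x' x'' : Fin m → X) (f : DualBallT X x₀) :
    ∑ j, ‖σ j * (f.toFun (x' j) - f.toFun (x'' j))‖ₑ ^ p.toReal
      ≤ weakNorm x₀ p σ x' x'' ^ p.toReal := by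
  have hp : 0 < p.toReal := ENNReal.toReal_pos h0 ht
  have h1 : eLpNorm (fun j => σ j * (f.toFun (x' j) - f.toFun (x'' j))) p Measure.count
      ≤ weakNorm x₀ p σ x' x'' :=
    le_iSup₂_of_le (f := fun f (_ : f ∈ dualBall X x₀) =>
      eLpNorm (fun j => σ j * (f (x' j) - f (x'' j))) p Measure.count)
      f.toFun ⟨f.lipschitz, f.vanish⟩ le_rfl
  rw [eLp_count _ p h0 ht] at h1
  have := ENNReal.rpow_le_rpow h1 hp.le
  rwa [← ENNReal.rpow_mul, one_div_mul_cancel hp.ne', ENNReal.rpow_one] at this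

lemma const_mul_eLp {Ω : Type*} [MeasurableSpace Ω] (c : ℝ) (f : Ω → ℝ) (p : ℝ≥0∞)
    (μ : Measure Ω) :
    ‖c‖ₑ * eLpNorm f p μ = eLpNorm (fun x => c * f x) p μ := by
  rw [← eLpNorm_const_smul]; rfl

lemma sum_int_le {X : Type*} [MetricSpace X] (x₀ : X) (p : ℝ≥0∞) (h0 : p ≠ 0) (ht : p ≠ ∞)
    {m : ℕ} (σ : Fin m → ℝ) (x' x'' : Fin m → X) (μ : Measure (DualBallT X x₀))
    [IsProbabilityMeasure μ] :
    ∑ j, (‖σ j‖ₑ * eLpNorm (fun f : DualBallT X x₀ => f.toFun (x' j) - f.toFun (x'' j)) p μ)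
        ^ p.toReal ≤ weakNorm x₀ p σ x' x'' ^ p.toReal := by
  have hp : 0 < p.toReal := ENNReal.toReal_pos h0 ht
  calc _ = ∑ j, ∫⁻ f : DualBallT X x₀,
        ‖σ j * (f.toFun (x' j) - f.toFun (x'' j))‖ₑ ^ p.toReal ∂μ := by
        refine Finset.sum_congr rfl fun j _ => ?_
        rw [const_mul_eLp, eLpNorm_eq_lintegral_rpow_enorm_toReal h0 ht, ← ENNReal.rpow_mul,
          one_div_mul_cancel hp.ne', ENNReal.rpow_one]
    _ = ∫⁻ f : DualBallT X x₀, ∑ j,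
        ‖σ j * (f.toFun (x' j) - f.toFun (x'' j))‖ₑ ^ p.toReal ∂μ := by
        rw [lintegral_finsetSum]
        intro j _
        exact (((measDual _ _).const_mul _).enorm).pow_const _
    _ ≤ ∫⁻ f : DualBallT X x₀, weakNorm x₀ p σ x' x'' ^ p.toReal ∂μ :=
        lintegral_mono fun f => weak_sum_le x₀ p h0 ht σ x' x'' f
    _ = _ := by simp

lemma each_le {X : Type*} [MetricSpace X] (x₀ : X) (p : ℝ≥0∞) (h0 : p ≠ 0)
    {m : ℕ} (σ : Fin m → ℝ) (x' x'' : Fin m → X) (μ : Measure (DualBallT X x₀))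
    [IsProbabilityMeasure μ] (j : Fin m) :
    ‖σ j‖ₑ * eLpNorm (fun f : DualBallT X x₀ => f.toFun (x' j) - f.toFun (x'' j)) p μ
      ≤ weakNorm x₀ p σ x' x'' := by
  by_cases ht : p = ∞
  · subst ht
    rw [const_mul_eLp, eLpNorm_exponent_top]
    refine eLpNormEssSup_le_of_ae_enorm_bound (Filter.Eventually.of_forall fun f => ?_)
    refine le_trans ?_ (le_iSup₂_of_le (f := fun f (_ : f ∈ dualBall X x₀) =>
      eLpNorm (fun j => σ j * (f (x' j) - f (x'' j))) ∞ Measure.count)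
      f.toFun ⟨f.lipschitz, f.vanish⟩ le_rfl)
    have := enorm_ae_le_eLpNormEssSup (fun j => σ j * (f.toFun (x' j) - f.toFun (x'' j)))
      Measure.count
    rw [Measure.ae_count_iff] at this
    rw [eLpNorm_exponent_top]
    exact this j
  · have hp : 0 < p.toReal := ENNReal.toReal_pos h0 ht
    rw [← ENNReal.rpow_le_rpow_iff hp]
    exact le_trans (Finset.single_le_sum (f := fun j => (‖σ j‖ₑ * eLpNorm
      (fun f : DualBallT X x₀ => f.toFun (x' j) - f.toFun (x'' j)) p μ) ^ p.toReal)
      (fun _ _ => zero_le) (Finset.mem_univ j)) (sum_int_le x₀ p h0 ht σ x' x'' μ)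

lemma sum_q_le {X : Type*} [MetricSpace X] (x₀ : X) (p q : ℝ≥0∞) (h0 : p ≠ 0) (hpq : p ≤ q)
    (ht : q ≠ ∞)
    {m : ℕ} (σ : Fin m → ℝ) (x' x'' : Fin m → X) (μ : Measure (DualBallT X x₀))
    [IsProbabilityMeasure μ] :
    ∑ j, (‖σ j‖ₑ * eLpNorm (fun f : DualBallT X x₀ => f.toFun (x' j) - f.toFun (x'' j)) p μ)
        ^ q.toReal ≤ weakNorm x₀ p σ x' x'' ^ q.toReal := by
  have hpt : p ≠ ∞ := ne_top_of_le_ne_top ht hpq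
  have hp : 0 < p.toReal := ENNReal.toReal_pos h0 hpt
  have hle : p.toReal ≤ q.toReal := ENNReal.toReal_mono ht hpq
  have split : ∀ a : ℝ≥0∞, a ^ q.toReal = a ^ p.toReal * a ^ (q.toReal - p.toReal) := fun a => by
    rw [← ENNReal.rpow_add_of_nonneg _ _ hp.le (by linarith)]; congr 1; ring
  simp only [split]
  calc _ ≤ ∑ j, (‖σ j‖ₑ * eLpNorm
      (fun f : DualBallT X x₀ => f.toFun (x' j) - f.toFun (x'' j)) p μ) ^ p.toReal *
        weakNorm x₀ p σ x' x'' ^ (q.toReal - p.toReal) := by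
        refine Finset.sum_le_sum fun j _ => ?_
        gcongr
        exact each_le x₀ p h0 σ x' x'' μ j
    _ ≤ _ := by
        rw [← Finset.sum_mul]
        gcongr
        exact sum_int_le x₀ p h0 hpt σ x' x'' μ

lemma mixed_le {Y : Type*} [MetricSpace Y] (y₀ : Y) (s q : ℝ≥0∞) {m : ℕ}
    (σ : Fin m → ℝ) (y' y'' : Fin m → Y) (τ : Fin m → ℝ) (hτ : ∀ j, τ j ≠ 0) (A : ℝ≥0∞)
    (B : ℝ≥0∞) (hA : eLpNorm τ (conjIdx q s) Measure.count ≤ A)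
    (hB : ∀ g : DualBallT Y y₀,
      eLpNorm (fun j => σ j / τ j * (g.toFun (y' j) - g.toFun (y'' j))) s Measure.count ≤ B) :
    mixedNorm y₀ s q σ y' y'' ≤ A * B := by
  refine (iInf₂_le τ hτ).trans (mul_le_mul' hA ?_)
  exact iSup₂_le fun f hf => hB ⟨f, hf.1, hf.2⟩

/-- case `q = s` -/
lemma case_eq {Y : Type*} [MetricSpace Y] (y₀ : Y) (s : ℝ≥0∞) (hs : s ≠ 0) {m : ℕ}
    (σ : Fin m → ℝ) (y' y'' : Fin m → Y) (M : ℝ≥0∞)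
    (H : ∀ ν : Measure (DualBallT Y y₀), IsProbabilityMeasure ν →
      (∀ j, ‖σ j‖ₑ * eLpNorm (fun g : DualBallT Y y₀ => g.toFun (y' j) - g.toFun (y'' j)) s ν ≤ M)
      ∧ (s ≠ ∞ → ∑ j, (‖σ j‖ₑ * eLpNorm
        (fun g : DualBallT Y y₀ => g.toFun (y' j) - g.toFun (y'' j)) s ν) ^ s.toReal
          ≤ M ^ s.toReal)) :
    mixedNorm y₀ s s σ y' y'' ≤ M := by
  rw [← one_mul M]
  refine mixed_le y₀ s s σ y' y'' (fun _ => 1) (fun _ => one_ne_zero) 1 M ?_ fun g => ?_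
  · have : conjIdx s s = ∞ := by simp [conjIdx]
    rw [this, eLpNorm_exponent_top]
    exact eLpNormEssSup_le_of_ae_enorm_bound (Filter.Eventually.of_forall fun j => by simp)
  · obtain ⟨H1, H2⟩ := H (Measure.dirac g) inferInstance
    have key : ∀ j, ‖σ j‖ₑ * eLpNorm
        (fun g : DualBallT Y y₀ => g.toFun (y' j) - g.toFun (y'' j)) s (Measure.dirac g)
        = ‖σ j * (g.toFun (y' j) - g.toFun (y'' j))‖ₑ := fun j => by
      rw [const_mul_eLp]
      have hm : Measurable (fun g : DualBallT Y y₀ => σ j * (g.toFun (y' j) - g.toFun (y'' j))) :=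
        (measDual _ _).const_mul _
      rw [← eLpNorm_congr_ae (f := fun _ => σ j * (g.toFun (y' j) - g.toFun (y'' j)))]
      · simp [eLpNorm_const _ hs]
      · exact ((ae_dirac_iff (measurableSet_eq_fun measurable_const hm)).2 rfl)
    simp only [key] at H1 H2
    simp only [div_one]
    by_cases ht : s = ∞
    · rw [ht, eLpNorm_exponent_top]
      exact eLpNormEssSup_le_of_ae_enorm_bound (Filter.Eventually.of_forall H1)
    · have hp : 0 < s.toReal := ENNReal.toReal_pos hs ht
      rw [eLp_count _ s hs ht, ← ENNReal.rpow_le_rpow_iff hp, ← ENNReal.rpow_mul,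
        one_div_mul_cancel hp.ne', ENNReal.rpow_one]
      exact H2 ht

/-- limiting argument -/
lemma lim_le {m : ℕ} (x : Fin m → ℝ) (hx : ∀ j, 0 ≤ x j) (θ r : ℝ) (hθ : 0 < θ) (hr : 0 < r) :
    Filter.Tendsto (fun δ : ℝ => ENNReal.ofReal ((∑ j, (x j + δ) ^ θ) ^ r))
      (nhdsWithin 0 (Set.Ioi 0)) (nhds (ENNReal.ofReal ((∑ j, (x j) ^ θ) ^ r))) := by
  have hc : Continuous (fun δ : ℝ => ENNReal.ofReal ((∑ j, (x j + δ) ^ θ) ^ r)) := by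
    refine ENNReal.continuous_ofReal.comp (Continuous.rpow_const ?_ fun _ => Or.inr hr.le)
    exact continuous_finsetSum _ fun j _ =>
      Continuous.rpow_const (by fun_prop) fun _ => Or.inr hθ.le
  have := (hc.tendsto 0).mono_left (nhdsWithin_le_nhds (s := Set.Ioi 0))
  simpa using this

def distFun {Y : Type*} [MetricSpace Y] (y₀ : Y) (y : Y) : DualBallT Y y₀ where
  toFun := fun z => dist z y - dist y₀ y
  lipschitz := by
    refine LipschitzWith.of_dist_le_mul fun a b => ?_
    simp only [NNReal.coe_one, one_mul, Real.dist_eq]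
    have := abs_dist_sub_le a b y
    simpa using this
  vanish := by simp

/-- case `s = ∞` -/
lemma case_top {Y : Type*} [MetricSpace Y] (y₀ : Y) (q : ℝ≥0∞) (hq : q ≠ 0) (hqt : q ≠ ∞) {m : ℕ}
    (σ : Fin m → ℝ) (y' y'' : Fin m → Y) (M : ℝ≥0∞) (hM : M ≠ ∞)
    (H : ∀ ν : Measure (DualBallT Y y₀), IsProbabilityMeasure ν →
      ∑ j, (‖σ j‖ₑ * eLpNorm
        (fun g : DualBallT Y y₀ => g.toFun (y' j) - g.toFun (y'' j)) ∞ ν) ^ q.toReal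
          ≤ M ^ q.toReal) :
    mixedNorm y₀ ∞ q σ y' y'' ≤ M := by
  have hp : 0 < q.toReal := ENNReal.toReal_pos hq hqt
  set x : Fin m → ℝ := fun j => |σ j| * dist (y' j) (y'' j) with hxdef
  have hx : ∀ j, 0 ≤ x j := fun j => mul_nonneg (abs_nonneg _) dist_nonneg
  have hconj : conjIdx q ∞ = q := by simp [conjIdx]
  have step : ENNReal.ofReal ((∑ j, (x j) ^ q.toReal) ^ (1 / q.toReal)) ≤ M := by
    rcases Nat.eq_zero_or_pos m with rfl | hm
    · simp [hp.ne']
    have hm0 : (m : ℝ≥0∞) ≠ 0 := by exact_mod_cast hm.ne'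
    have hmt : (m : ℝ≥0∞) ≠ ∞ := ENNReal.natCast_ne_top m
    set ν : Measure (DualBallT Y y₀) :=
      (m : ℝ≥0∞)⁻¹ • ∑ j : Fin m, Measure.dirac (distFun y₀ (y'' j)) with hν
    have hprob : IsProbabilityMeasure ν := ⟨by
      simp [hν, ENNReal.inv_mul_cancel hm0 hmt]⟩
    have H1 := H ν hprob
    have low : ∀ j, ENNReal.ofReal (x j) ≤ ‖σ j‖ₑ * eLpNorm
        (fun g : DualBallT Y y₀ => g.toFun (y' j) - g.toFun (y'' j)) ∞ ν := fun j => by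
      rw [hxdef]
      simp only []
      rw [ENNReal.ofReal_mul (abs_nonneg _), ← Real.enorm_eq_ofReal_abs]
      gcongr
      have hae := enorm_ae_le_eLpNormEssSup
        (fun g : DualBallT Y y₀ => g.toFun (y' j) - g.toFun (y'' j)) ν
      have hle : (m : ℝ≥0∞)⁻¹ • Measure.dirac (distFun y₀ (y'' j)) ≤ ν := by
        rw [hν]
        refine Measure.le_iff.2 fun t _ => ?_
        simp only [Measure.smul_apply, Measure.finsetSum_apply, smul_eq_mul]
        gcongr
        exact Finset.single_le_sum (f := fun j => Measure.dirac (distFun y₀ (y'' j)) t)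
          (fun _ _ => zero_le) (Finset.mem_univ j)
      have hae2 := ae_mono hle hae
      have hinv : (m : ℝ≥0∞)⁻¹ ≠ 0 := ENNReal.inv_ne_zero.2 hmt
      have hae3 : ∀ᵐ g ∂(Measure.dirac (distFun y₀ (y'' j))),
          ‖g.toFun (y' j) - g.toFun (y'' j)‖ₑ ≤ eLpNormEssSup
            (fun g : DualBallT Y y₀ => g.toFun (y' j) - g.toFun (y'' j)) ν :=
        (Measure.absolutelyContinuous_smul hinv).ae_le hae2
      rw [ae_dirac_iff (measurableSet_le (measDual _ _).enorm measurable_const)] at hae3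
      rw [eLpNorm_exponent_top]
      refine le_trans (le_of_eq ?_) hae3
      simp [distFun, Real.enorm_eq_ofReal_abs]
    have H2 : ∑ j, ENNReal.ofReal (x j) ^ q.toReal ≤ M ^ q.toReal :=
      (Finset.sum_le_sum fun j _ => ENNReal.rpow_le_rpow (low j) hp.le).trans H1
    rw [← ENNReal.ofReal_rpow_of_nonneg (Finset.sum_nonneg fun j _ =>
      Real.rpow_nonneg (hx j) _) (by positivity), ENNReal.ofReal_sum_of_nonneg
      (fun j _ => Real.rpow_nonneg (hx j) _), ← ENNReal.rpow_le_rpow_iff hp, ← ENNReal.rpow_mul,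
        one_div_mul_cancel hp.ne', ENNReal.rpow_one]
    refine le_trans (le_of_eq (Finset.sum_congr rfl fun j _ => ?_)) H2
    rw [ENNReal.ofReal_rpow_of_nonneg (hx j) hp.le]
  refine le_trans ?_ step
  refine ge_of_tendsto (lim_le x hx q.toReal (1 / q.toReal) hp (by positivity)) ?_
  filter_upwards [self_mem_nhdsWithin] with δ hδ
  have hδ : 0 < δ := hδ
  have hpos : ∀ j, 0 < x j + δ := fun j => by linarith [hx j]
  rw [← mul_one (ENNReal.ofReal _)]
  refine mixed_le y₀ ∞ q σ y' y'' (fun j => x j + δ) (fun j => (hpos j).ne') _ 1 ?_ fun g => ?_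
  · rw [hconj, eLp_count_real _ q hq hqt]
    simp only [abs_of_pos (hpos _)]
    exact le_rfl
  · rw [eLpNorm_exponent_top]
    refine eLpNormEssSup_le_of_ae_enorm_bound (Filter.Eventually.of_forall fun j => ?_)
    rw [Real.enorm_eq_ofReal_abs, ENNReal.ofReal_le_one, abs_mul, abs_div, abs_of_pos (hpos j),
      div_mul_eq_mul_div, div_le_one (hpos j)]
    have : |g.toFun (y' j) - g.toFun (y'' j)| ≤ dist (y' j) (y'' j) := by
      have := g.lipschitz.dist_le_mul (y' j) (y'' j)
      simpa [Real.dist_eq] using this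
    have := mul_le_mul_of_nonneg_left this (abs_nonneg (σ j))
    simp only [hxdef]
    linarith

/-- case `q < s < ∞` -/
lemma case_main {Y : Type*} [MetricSpace Y] (y₀ : Y) (q s : ℝ≥0∞) (hq : q ≠ 0) (hqs : q < s)
    (hs : s ≠ ∞) {m : ℕ}
    (σ : Fin m → ℝ) (y' y'' : Fin m → Y) (M : ℝ≥0∞) (hM : M ≠ ∞)
    (H : ∀ ν : Measure (DualBallT Y y₀), IsProbabilityMeasure ν →
      ∑ j, (‖σ j‖ₑ * eLpNorm
        (fun g : DualBallT Y y₀ => g.toFun (y' j) - g.toFun (y'' j)) s ν) ^ q.toReal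
          ≤ M ^ q.toReal) :
    mixedNorm y₀ s q σ y' y'' ≤ M := by
  have hqt : q ≠ ∞ := hqs.ne_top
  have hs0 : s ≠ 0 := (hq.bot_lt.trans hqs).ne'
  set a : ℝ := q.toReal with ha
  set b : ℝ := s.toReal with hb
  have hap : 0 < a := ENNReal.toReal_pos hq hqt
  have hbp : 0 < b := ENNReal.toReal_pos hs0 hs
  have hab : a < b := (ENNReal.toReal_lt_toReal hqt hs).2 hqs
  set θ : ℝ := a / b with hθ
  have hθ0 : 0 < θ := div_pos hap hbp
  have hθ1 : θ < 1 := (div_lt_one hbp).2 hab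
  set r : ℝ := (1 / a - 1 / b)⁻¹ with hr
  have hinv : 0 < 1 / a - 1 / b := sub_pos.2 (one_div_lt_one_div_of_lt hap hab)
  have hrp : 0 < r := inv_pos.2 hinv
  have hconj : conjIdx q s = ENNReal.ofReal r := by
    rw [conjIdx, hr, ENNReal.ofReal_inv_of_pos hinv, ENNReal.ofReal_sub _ (by positivity),
      one_div, one_div, one_div, one_div, ENNReal.ofReal_inv_of_pos hap,
      ENNReal.ofReal_inv_of_pos hbp, ENNReal.ofReal_toReal hqt, ENNReal.ofReal_toReal hs]
  set V : DualBallT Y y₀ → Fin m → ℝ :=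
    fun g j => |σ j * (g.toFun (y' j) - g.toFun (y'' j))| ^ b with hV
  have hmeas : ∀ j, Measurable (fun g : DualBallT Y y₀ =>
      ‖σ j * (g.toFun (y' j) - g.toFun (y'' j))‖ₑ ^ b) := fun j =>
    (((measDual _ _).const_mul _).enorm).pow_const _
  set P : Set (Fin m → ℝ) := {v | (∀ j, 0 ≤ v j) ∧ ∃ ν : Measure (DualBallT Y y₀),
    IsProbabilityMeasure ν ∧ ∀ j, ENNReal.ofReal (v j) =
      ∫⁻ g, ‖σ j * (g.toFun (y' j) - g.toFun (y'' j))‖ₑ ^ b ∂ν} with hP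
  have hVP : Set.range V ⊆ P := by
    rintro _ ⟨g, rfl⟩
    refine ⟨fun j => Real.rpow_nonneg (abs_nonneg _) _, Measure.dirac g, inferInstance, fun j => ?_⟩
    rw [lintegral_dirac' g (hmeas j), Real.enorm_eq_ofReal_abs,
      ENNReal.ofReal_rpow_of_nonneg (abs_nonneg _) hbp.le]
  have hPconv : Convex ℝ P := by
    rintro v ⟨hv0, ν, hν, hv⟩ w ⟨hw0, ν', hν', hw⟩ c d hc hd hcd
    refine ⟨fun j => by
      have := mul_nonneg hc (hv0 j); have := mul_nonneg hd (hw0 j)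
      simp only [Pi.add_apply, Pi.smul_apply, smul_eq_mul]; linarith,
      ENNReal.ofReal c • ν + ENNReal.ofReal d • ν', ⟨?_⟩, fun j => ?_⟩
    · simp [← ENNReal.ofReal_add hc hd, hcd]
    · rw [lintegral_add_measure, lintegral_smul_measure, lintegral_smul_measure, ← hv j, ← hw j]
      simp only [Pi.add_apply, Pi.smul_apply, smul_eq_mul]
      rw [ENNReal.ofReal_add (mul_nonneg hc (hv0 j)) (mul_nonneg hd (hw0 j)),
        ENNReal.ofReal_mul hc, ENNReal.ofReal_mul hd]
  have hPsum : ∀ v ∈ P, ∑ j, v j ^ θ ≤ M.toReal ^ a := by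
    rintro v ⟨hv0, ν, hν, hv⟩
    have h1 := H ν hν
    have h2 : ∀ j, (‖σ j‖ₑ * eLpNorm
        (fun g : DualBallT Y y₀ => g.toFun (y' j) - g.toFun (y'' j)) s ν) ^ a
        = ENNReal.ofReal (v j ^ θ) := fun j => by
      rw [const_mul_eLp, eLpNorm_eq_lintegral_rpow_enorm_toReal hs0 hs, ← hb, ← hv j,
        ← ENNReal.rpow_mul, ← ENNReal.ofReal_rpow_of_nonneg (hv0 j) hθ0.le, hθ]
      congr 1; ring
    simp only [h2] at h1
    rw [← ENNReal.ofReal_sum_of_nonneg (fun j _ => Real.rpow_nonneg (hv0 j) _),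
      ← ENNReal.ofReal_toReal hM, ENNReal.ofReal_rpow_of_nonneg ENNReal.toReal_nonneg hap.le] at h1
    exact (ENNReal.ofReal_le_ofReal_iff (Real.rpow_nonneg ENNReal.toReal_nonneg _)).1 h1
  set S : Set (Fin m → ℝ) := closure (convexHull ℝ (Set.range V)) with hS
  have hbdd : Bornology.IsBounded (Set.range V) := by
    refine (Metric.isBounded_Icc (0 : Fin m → ℝ)
      (fun j => (|σ j| * dist (y' j) (y'' j)) ^ b)).subset ?_
    rintro _ ⟨g, rfl⟩
    refine ⟨fun j => Real.rpow_nonneg (abs_nonneg _) _, fun j => ?_⟩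
    refine Real.rpow_le_rpow (abs_nonneg _) ?_ hbp.le
    rw [abs_mul]
    refine mul_le_mul_of_nonneg_left ?_ (abs_nonneg _)
    have := g.lipschitz.dist_le_mul (y' j) (y'' j)
    simpa [Real.dist_eq] using this
  have hScomp : IsCompact S := (isBounded_convexHull.2 hbdd).isCompact_closure
  have hSconv : Convex ℝ S := (convex_convexHull ℝ _).closure
  have hVS : ∀ g, V g ∈ S := fun g => subset_closure (subset_convexHull ℝ _ ⟨g, rfl⟩)
  have hSprop : S ⊆ {v | (∀ j, 0 ≤ v j) ∧ ∑ j, v j ^ θ ≤ M.toReal ^ a} := by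
    refine closure_minimal (fun v hv => ?_) ?_
    · have hvP := convexHull_min hVP hPconv hv
      exact ⟨hvP.1, hPsum v hvP⟩
    · rw [Set.setOf_and]
      refine IsClosed.inter ?_ (isClosed_le ?_ continuous_const)
      · simp only [Set.setOf_forall]
        exact isClosed_iInter fun j => isClosed_le continuous_const (continuous_apply j)
      · exact continuous_finsetSum _ fun j _ =>
          Continuous.rpow_const (continuous_apply j) fun _ => Or.inr hθ0.le
  have hlim : Filter.Tendsto (fun δ : ℝ => ENNReal.ofReal ((M.toReal ^ a + m * δ ^ θ) ^ (1 / a)))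
      (nhdsWithin 0 (Set.Ioi 0)) (nhds M) := by
    have hc : Continuous (fun δ : ℝ => ENNReal.ofReal ((M.toReal ^ a + m * δ ^ θ) ^ (1 / a))) := by
      refine ENNReal.continuous_ofReal.comp (Continuous.rpow_const ?_ fun _ => Or.inr (by positivity))
      exact continuous_const.add (continuous_const.mul
        (Continuous.rpow_const continuous_id fun _ => Or.inr hθ0.le))
    have := (hc.tendsto 0).mono_left (nhdsWithin_le_nhds (s := Set.Ioi 0))
    rw [Real.zero_rpow hθ0.ne', mul_zero, add_zero, ← Real.rpow_mul ENNReal.toReal_nonneg,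
      mul_one_div_cancel hap.ne', Real.rpow_one, ENNReal.ofReal_toReal hM] at this
    exact this
  refine ge_of_tendsto hlim ?_
  filter_upwards [self_mem_nhdsWithin] with δ hδ
  have hδ : 0 < δ := hδ
  obtain ⟨u, huS, hu⟩ := core S θ hθ0 hSconv hScomp ⟨_, hVS (distFun y₀ y₀)⟩
    (fun v hv => (hSprop hv).1) δ hδ
  have hpos : ∀ j, 0 < u j + δ := fun j => by linarith [(hSprop huS).1 j]
  set Z : ℝ := ∑ j, (u j + δ) ^ θ with hZ
  have hZ0 : 0 ≤ Z := Finset.sum_nonneg fun j _ => Real.rpow_nonneg (hpos j).le _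
  have hZle : Z ≤ M.toReal ^ a + m * δ ^ θ := by
    have h1 : Z ≤ ∑ j, (u j ^ θ + δ ^ θ) := Finset.sum_le_sum fun j _ =>
      Real.rpow_add_le_add_rpow ((hSprop huS).1 j) hδ.le hθ0.le hθ1.le
    rw [Finset.sum_add_distrib] at h1
    simp only [Finset.sum_const, Finset.card_univ, Fintype.card_fin, nsmul_eq_mul] at h1
    linarith [(hSprop huS).2]
  have hτpos : ∀ j, 0 < (u j + δ) ^ ((1 - θ) / b) := fun j => Real.rpow_pos_of_pos (hpos j) _
  have hprod : ENNReal.ofReal (Z ^ (1 / r)) * ENNReal.ofReal (Z ^ (1 / b))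
      ≤ ENNReal.ofReal ((M.toReal ^ a + m * δ ^ θ) ^ (1 / a)) := by
    rw [← ENNReal.ofReal_mul (Real.rpow_nonneg hZ0 _), ← Real.rpow_add_of_nonneg hZ0
      (by positivity) (by positivity)]
    have : 1 / r + 1 / b = 1 / a := by rw [hr, one_div, inv_inv]; ring
    rw [this]
    exact ENNReal.ofReal_le_ofReal (Real.rpow_le_rpow hZ0 hZle (by positivity))
  refine le_trans ?_ hprod
  refine mixed_le y₀ s q σ y' y'' (fun j => (u j + δ) ^ ((1 - θ) / b))
    (fun j => (hτpos j).ne') _ _ ?_ fun g => ?_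
  · rw [hconj, eLp_count_real _ _ (by simpa using hrp) ENNReal.ofReal_ne_top,
      ENNReal.toReal_ofReal hrp.le]
    refine le_of_eq ?_
    congr 2
    refine Finset.sum_congr rfl fun j _ => ?_
    rw [abs_of_pos (hτpos j), ← Real.rpow_mul (hpos j).le]
    congr 1
    rw [hr, hθ]
    have : b - a ≠ 0 := by linarith
    field_simp
  · rw [eLp_count_real _ s hs0 hs, ← hb]
    refine ENNReal.ofReal_le_ofReal (Real.rpow_le_rpow (Finset.sum_nonneg fun j _ =>
      Real.rpow_nonneg (abs_nonneg _) _) ?_ (by positivity))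
    refine le_trans (le_of_eq (Finset.sum_congr rfl fun j _ => ?_)) (hu (V g) (hVS g))
    rw [div_mul_eq_mul_div, abs_div, abs_of_pos (hτpos j),
      Real.div_rpow (abs_nonneg _) (hτpos j).le, ← Real.rpow_mul (hpos j).le,
      div_mul_cancel₀ _ hbp.ne', div_eq_mul_inv, ← Real.rpow_neg (hpos j).le, neg_sub, mul_comm]

/-- a Pietsch-domination-type sufficient condition. If there is `C ≥ 0` such
that for every Borel probability measure `ν` on `B_{Y^#}` there is a Borel probability
measure `μ` on `B_{X^#}` with
`(∫ |g(Ta)-g(Tb)|^s dν)^{1/s} ≤ C (∫ |f(a)-f(b)|^p dμ)^{1/p}` for all `a b : X`, then `T`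
is Lipschitz `(m^L(s;q),p)`-summing with `π^L_{(m^L(s;q),p)}(T) ≤ C`. -/
theorem stmt3 {X Y : Type*} [MetricSpace X] [MetricSpace Y] (x₀ : X) (y₀ : Y)
    (s q p : ℝ≥0∞) (hq : 0 < q) (hqs : q ≤ s) (hp : 0 < p) (hpq : p ≤ q)
    (T : X → Y) (K : ℝ≥0) (hT : LipschitzWith K T) (C : ℝ≥0)
    (h : ∀ ν : Measure (DualBallT Y y₀), IsProbabilityMeasure ν →
      ∃ μ : Measure (DualBallT X x₀), IsProbabilityMeasure μ ∧
        ∀ a b : X,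
          eLpNorm (fun g : DualBallT Y y₀ => g.toFun (T a) - g.toFun (T b)) s ν ≤
            C * eLpNorm (fun f : DualBallT X x₀ => f.toFun a - f.toFun b) p μ) :
    LipMixedP x₀ y₀ s q p T ∧ lipMixedPNorm x₀ y₀ s q p T ≤ C := by
  have bound : ∀ (m : ℕ) (σ : Fin m → ℝ) (x' x'' : Fin m → X),
      mixedNorm y₀ s q σ (T ∘ x') (T ∘ x'') ≤ C * weakNorm x₀ p σ x' x'' := by
    intro m σ x' x''
    by_cases hM : C * weakNorm x₀ p σ x' x'' = ∞
    · rw [hM]; exact le_top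
    have H1 : ∀ ν : Measure (DualBallT Y y₀), IsProbabilityMeasure ν →
        (∀ j, ‖σ j‖ₑ * eLpNorm (fun g : DualBallT Y y₀ =>
          g.toFun ((T ∘ x') j) - g.toFun ((T ∘ x'') j)) s ν ≤ C * weakNorm x₀ p σ x' x'')
        ∧ (q ≠ ∞ → ∑ j, (‖σ j‖ₑ * eLpNorm (fun g : DualBallT Y y₀ =>
          g.toFun ((T ∘ x') j) - g.toFun ((T ∘ x'') j)) s ν) ^ q.toReal
            ≤ (C * weakNorm x₀ p σ x' x'') ^ q.toReal) := by
      intro ν hν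
      obtain ⟨μ, hμ, hle⟩ := h ν hν
      have hj : ∀ j, ‖σ j‖ₑ * eLpNorm (fun g : DualBallT Y y₀ =>
          g.toFun ((T ∘ x') j) - g.toFun ((T ∘ x'') j)) s ν ≤
          C * (‖σ j‖ₑ * eLpNorm (fun f : DualBallT X x₀ => f.toFun (x' j) - f.toFun (x'' j)) p μ) :=
        fun j => by
          rw [mul_left_comm]
          exact mul_le_mul_right (hle (x' j) (x'' j)) _
      refine ⟨fun j => (hj j).trans (mul_le_mul_right (each_le x₀ p hp.ne' σ x' x'' μ j) _),
        fun hqt => ?_⟩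
      have hq0 : 0 < q.toReal := ENNReal.toReal_pos hq.ne' hqt
      refine (Finset.sum_le_sum fun j _ => ENNReal.rpow_le_rpow (hj j) hq0.le).trans ?_
      have e : ∀ t : ℝ≥0∞, ((C : ℝ≥0∞) * t) ^ q.toReal = (C : ℝ≥0∞) ^ q.toReal * t ^ q.toReal :=
        fun t => ENNReal.mul_rpow_of_nonneg _ _ hq0.le
      simp only [e]
      rw [← Finset.mul_sum]
      exact mul_le_mul_right (sum_q_le x₀ p q hp.ne' hpq hqt σ x' x'' μ) _
    rcases hqs.eq_or_lt with rfl | hlt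
    · exact case_eq y₀ q hq.ne' σ _ _ _ H1
    by_cases hs : s = ∞
    · subst hs
      exact case_top y₀ q hq.ne' hlt.ne σ _ _ _ hM fun ν hν => (H1 ν hν).2 hlt.ne
    · exact case_main y₀ q s hq.ne' hlt hs σ _ _ _ hM fun ν hν => (H1 ν hν).2 hlt.ne_top
  exact ⟨⟨C, bound⟩, sInf_le bound⟩
end
end

section
/- Let X and Y be pointed metric spaces. Suppose 0 < p₁ ≤ p₂, 0 < q₁ ≤ q₂, 0 < s₁ ≤ s₂, with q_j ≤ s_j and q_j ≤ p_j for j = 1,2, and 1/q₁ − 1/q₂ ≤ 1/s₁ − 1/s₂ ≤ 1/p₁ − 1/p₂. Then every Lipschitz (p₁,m^L(s₁;q₁))-summing map T : X → Y is Lipschitz (p₂,m^L(s₂;q₂))-summing and π^L_{(p₂,m^L(s₂;q₂))}(T) ≤ π^L_{(p₁,m^L(s₁;q₁))}(T). -/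
open MeasureTheory ENNReal NNReal

noncomputable section

lemma aux_eLp {m : ℕ} (a : Fin m → ℝ) {p : ℝ≥0∞} (h0 : p ≠ 0) (ht : p ≠ ∞) :
    eLpNorm a p Measure.count = (∑ j, ‖a j‖ₑ ^ p.toReal) ^ (1 / p.toReal) := by
  rw [eLpNorm_eq_lintegral_rpow_enorm_toReal h0 ht, lintegral_count, tsum_fintype]

lemma aux_mono {m : ℕ} (a : Fin m → ℝ) {p q : ℝ≥0∞} (h0 : p ≠ 0) (hpq : p ≤ q) :
    eLpNorm a q Measure.count ≤ eLpNorm a p Measure.count := by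
  by_cases hq : q = ∞
  · subst hq
    rw [eLpNorm_exponent_top, eLpNormEssSup_eq_essSup_enorm, essSup_count]
    exact iSup_le fun j => enorm_le_eLpNorm_count a j h0
  have hp : p ≠ ∞ := ne_top_of_le_ne_top hq hpq
  have hq0 : q ≠ 0 := (lt_of_lt_of_le (pos_iff_ne_zero.2 h0) hpq).ne'
  have hP : 0 < p.toReal := ENNReal.toReal_pos h0 hp
  have hQ : 0 < q.toReal := ENNReal.toReal_pos hq0 hq
  have hPQ : p.toReal ≤ q.toReal := ENNReal.toReal_mono hq hpq
  have hA : ∀ j, ‖a j‖ₑ ≤ eLpNorm a p Measure.count := fun j => enorm_le_eLpNorm_count a j h0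
  have hS : ∑ j, ‖a j‖ₑ ^ p.toReal = eLpNorm a p Measure.count ^ p.toReal := by
    rw [aux_eLp a h0 hp, ← ENNReal.rpow_mul, one_div, inv_mul_cancel₀ hP.ne', ENNReal.rpow_one]
  rw [aux_eLp a hq0 hq, one_div, ENNReal.rpow_inv_le_iff hQ]
  calc ∑ j, ‖a j‖ₑ ^ q.toReal
      = ∑ j, ‖a j‖ₑ ^ p.toReal * ‖a j‖ₑ ^ (q.toReal - p.toReal) := by
        refine Finset.sum_congr rfl fun j _ => ?_
        rw [← ENNReal.rpow_add_of_nonneg _ _ hP.le (by linarith)]; congr 1; ring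
    _ ≤ ∑ j, ‖a j‖ₑ ^ p.toReal * eLpNorm a p Measure.count ^ (q.toReal - p.toReal) := by
        refine Finset.sum_le_sum fun j _ => ?_
        exact mul_le_mul_right (ENNReal.rpow_le_rpow (hA j) (by linarith)) _
    _ = eLpNorm a p Measure.count ^ q.toReal := by
        rw [← Finset.sum_mul, hS, ← ENNReal.rpow_add_of_nonneg _ _ hP.le (by linarith)]
        congr 1; ring

lemma aux_mult {m : ℕ} (a : Fin m → ℝ) {p q : ℝ≥0∞} (h0 : p ≠ 0) (hpq : p ≤ q) (B : ℝ≥0∞)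
    (H : ∀ w : Fin m → ℝ, eLpNorm (fun j => w j * a j) p Measure.count
      ≤ eLpNorm w (1 / p - 1 / q)⁻¹ Measure.count * B) :
    eLpNorm a q Measure.count ≤ B := by
  rcases hpq.eq_or_lt with rfl | hlt
  · have := H (fun _ => 1)
    simp only [one_mul, tsub_self, ENNReal.inv_zero] at this
    refine this.trans ?_
    calc _ ≤ 1 * B := by
          gcongr
          rw [eLpNorm_exponent_top, eLpNormEssSup_eq_essSup_enorm, essSup_count]
          exact iSup_le fun j => by simp
      _ = B := one_mul B
  have hp : p ≠ ∞ := hlt.ne_top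
  by_cases hq : q = ∞
  · subst hq
    rw [eLpNorm_exponent_top, eLpNormEssSup_eq_essSup_enorm, essSup_count]
    refine iSup_le fun j => ?_
    have := H (Set.indicator {j} fun _ => 1)
    simp only [one_div, ENNReal.inv_top, tsub_zero, inv_inv] at this
    have e : (fun i => (Set.indicator {j} (fun _ => (1:ℝ))) i * a i)
        = Set.indicator {j} fun _ => a j := by
      ext i
      by_cases h : i = j
      · subst h; simp
      · simp [h]
    rw [e, eLpNorm_indicator_const (measurableSet_singleton j) h0 hp,
      eLpNorm_indicator_const (measurableSet_singleton j) h0 hp] at this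
    simpa using this
  have hq0 : q ≠ 0 := (lt_of_le_of_lt (zero_le) hlt).ne'
  have hP : 0 < p.toReal := ENNReal.toReal_pos h0 hp
  have hQ : 0 < q.toReal := ENNReal.toReal_pos hq0 hq
  have hPQ : p.toReal < q.toReal := (ENNReal.toReal_lt_toReal hp hq).2 hlt
  set r : ℝ≥0∞ := (1 / p - 1 / q)⁻¹ with hr
  have hR : r.toReal⁻¹ = p.toReal⁻¹ - q.toReal⁻¹ := by
    rw [hr, ENNReal.toReal_inv, inv_inv, one_div, one_div,
      ENNReal.toReal_sub_of_le (ENNReal.inv_le_inv.2 hpq) (by simpa using h0),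
      ENNReal.toReal_inv, ENNReal.toReal_inv]
  have hRi : 0 < r.toReal⁻¹ := by
    rw [hR]; exact sub_pos.2 ((inv_lt_inv₀ hQ hP).2 hPQ)
  have hRp : 0 < r.toReal := inv_pos.1 hRi
  have hr0 : r ≠ 0 := by rintro h; simp [h] at hRp
  have hrt : r ≠ ∞ := by rintro h; simp [h] at hRp
  have hw := H (fun j => |a j| ^ (q.toReal * r.toReal⁻¹))
  have hnn : 0 ≤ q.toReal * r.toReal⁻¹ := by positivity
  have en : ∀ j, ‖|a j| ^ (q.toReal * r.toReal⁻¹)‖ₑ = ‖a j‖ₑ ^ (q.toReal * r.toReal⁻¹) := by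
    intro j
    rw [Real.enorm_rpow_of_nonneg (abs_nonneg _) hnn]
    simp [← ofReal_norm]
  rw [aux_eLp _ h0 hp, aux_eLp _ hr0 hrt] at hw
  have e1 : ∀ j, ‖|a j| ^ (q.toReal * r.toReal⁻¹)‖ₑ ^ r.toReal = ‖a j‖ₑ ^ q.toReal := by
    intro j
    rw [en, ← ENNReal.rpow_mul]; congr 1; field_simp
  have e2 : ∀ j, ‖|a j| ^ (q.toReal * r.toReal⁻¹) * a j‖ₑ ^ p.toReal = ‖a j‖ₑ ^ q.toReal := by
    intro j
    rw [enorm_mul, en]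
    nth_rewrite 2 [← ENNReal.rpow_one ‖a j‖ₑ]
    rw [← ENNReal.rpow_add_of_nonneg _ _ hnn zero_le_one, ← ENNReal.rpow_mul]
    congr 1; rw [hR]; field_simp; ring
  simp only [e1, e2] at hw
  rw [aux_eLp a hq0 hq]
  set S := ∑ j, ‖a j‖ₑ ^ q.toReal with hS
  by_cases hS0 : S = 0
  · rw [hS0, ENNReal.zero_rpow_of_pos (by positivity)]; exact zero_le
  have hSt : S ≠ ∞ := by
    rw [hS]
    exact ENNReal.sum_ne_top.2 fun j _ => ENNReal.rpow_ne_top_of_nonneg hQ.le enorm_ne_top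
  have e3 : 1 / p.toReal = 1 / r.toReal + 1 / q.toReal := by
    rw [one_div, one_div, one_div, hR]; ring
  rw [e3, ENNReal.rpow_add _ _ hS0 hSt] at hw
  refine (ENNReal.mul_le_mul_iff_right ?_ ?_).1 hw
  · simp [ENNReal.rpow_eq_zero_iff, hS0, hSt]
  · exact ENNReal.rpow_ne_top_of_nonneg (by positivity) hSt

lemma aux_main {X Y : Type*} [MetricSpace X] [MetricSpace Y] (x₀ : X)
    (p₁ p₂ q₁ q₂ s₁ s₂ : ℝ≥0∞)
    (hp₁ : 0 < p₁) (hp : p₁ ≤ p₂) (hq₁ : 0 < q₁) (hq : q₁ ≤ q₂)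
    (hs₁ : 0 < s₁) (hs : s₁ ≤ s₂)
    (hq₁s₁ : q₁ ≤ s₁) (hq₂s₂ : q₂ ≤ s₂)
    (h1 : 1 / q₁ - 1 / q₂ ≤ 1 / s₁ - 1 / s₂) (h2 : 1 / s₁ - 1 / s₂ ≤ 1 / p₁ - 1 / p₂)
    (T : X → Y) (C : ℝ≥0∞) (hC : C ≠ ∞)
    (H : ∀ (m : ℕ) (σ : Fin m → ℝ) (x' x'' : Fin m → X),
      strongNorm p₁ σ (T ∘ x') (T ∘ x'') ≤ C * mixedNorm x₀ s₁ q₁ σ x' x'')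
    (m : ℕ) (σ : Fin m → ℝ) (x' x'' : Fin m → X) :
    strongNorm p₂ σ (T ∘ x') (T ∘ x'') ≤ C * mixedNorm x₀ s₂ q₂ σ x' x'' := by
  have hq₂ : 0 < q₂ := hq₁.trans_le hq
  have hs₂ : 0 < s₂ := hs₁.trans_le hs
  have hidx : conjIdx q₂ s₂ ≤ conjIdx q₁ s₁ := by
    unfold conjIdx
    rw [ENNReal.inv_le_inv]
    simp only [one_div] at h1 ⊢
    have a1 : q₁⁻¹ ≠ ∞ := by simpa using hq₁.ne'
    have a2 : q₂⁻¹ ≠ ∞ := by simpa using hq₂.ne'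
    have a3 : s₁⁻¹ ≠ ∞ := by simpa using hs₁.ne'
    have a4 : s₂⁻¹ ≠ ∞ := by simpa using hs₂.ne'
    have b1 := ENNReal.inv_le_inv.2 hq
    have b2 := ENNReal.inv_le_inv.2 hs
    have b3 := ENNReal.inv_le_inv.2 hq₁s₁
    have b4 := ENNReal.inv_le_inv.2 hq₂s₂
    generalize q₁⁻¹ = u1 at *
    generalize q₂⁻¹ = u2 at *
    generalize s₁⁻¹ = u3 at *
    generalize s₂⁻¹ = u4 at *
    lift u1 to ℝ≥0 using a1
    lift u2 to ℝ≥0 using a2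
    lift u3 to ℝ≥0 using a3
    lift u4 to ℝ≥0 using a4
    norm_cast at *
    rw [← NNReal.coe_le_coe] at *
    rw [NNReal.coe_sub b1, NNReal.coe_sub b2] at h1
    rw [NNReal.coe_sub b3, NNReal.coe_sub b4]
    linarith
  have hc0 : conjIdx q₂ s₂ ≠ 0 := by
    unfold conjIdx
    rw [Ne, ENNReal.inv_eq_zero]
    exact (lt_of_le_of_lt tsub_le_self (by simpa using hq₂)).ne
  set r : ℝ≥0∞ := (1 / p₁ - 1 / p₂)⁻¹ with hr
  set t : ℝ≥0∞ := (1 / s₁ - 1 / s₂)⁻¹ with ht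
  have hrt : r ≤ t := ENNReal.inv_le_inv.2 h2
  have hr0 : r ≠ 0 := by
    rw [hr, Ne, ENNReal.inv_eq_zero]
    exact (lt_of_le_of_lt tsub_le_self (by simpa using hp₁)).ne
  haveI : HolderTriple t s₂ s₁ := ⟨by
    rw [ht, inv_inv, one_div, one_div]
    exact tsub_add_cancel_of_le (ENNReal.inv_le_inv.2 hs)⟩
  have key : ∀ τ : {τ : Fin m → ℝ // ∀ j, τ j ≠ 0},
      strongNorm p₂ σ (T ∘ x') (T ∘ x'') ≤ C * (eLpNorm τ.1 (conjIdx q₂ s₂) Measure.count *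
        weakNorm x₀ s₂ (fun j => σ j / τ.1 j) x' x'') := by
    rintro ⟨τ, hτ⟩
    refine aux_mult _ hp₁.ne' hp _ fun w => ?_
    have hw : weakNorm x₀ s₁ (fun j => w j * σ j / τ j) x' x'' ≤
        eLpNorm w r Measure.count * weakNorm x₀ s₂ (fun j => σ j / τ j) x' x'' := by
      refine iSup₂_le fun f hf => ?_
      have e : (fun j => w j * σ j / τ j * (f (x' j) - f (x'' j)))
          = w • (fun j => σ j / τ j * (f (x' j) - f (x'' j))) := by
        ext j; simp only [Pi.smul_apply', smul_eq_mul]; ring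
      rw [e]
      refine (eLpNorm_smul_le_mul_eLpNorm (p := t) (q := s₂)
        (MemLp.of_discrete (p := 0)).1 (MemLp.of_discrete (p := 0)).1).trans ?_
      refine mul_le_mul' (aux_mono w hr0 hrt) ?_
      exact le_iSup₂ (f := fun f (_ : f ∈ dualBall X x₀) =>
        eLpNorm (fun j => σ j / τ j * (f (x' j) - f (x'' j))) s₂ Measure.count) f hf
    calc eLpNorm (fun j => w j * (σ j * dist ((T ∘ x') j) ((T ∘ x'') j))) p₁ Measure.count
        = strongNorm p₁ (fun j => w j * σ j) (T ∘ x') (T ∘ x'') := by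
          unfold strongNorm; simp only [mul_assoc]
      _ ≤ C * mixedNorm x₀ s₁ q₁ (fun j => w j * σ j) x' x'' := H _ _ _ _
      _ ≤ C * (eLpNorm τ (conjIdx q₁ s₁) Measure.count *
            weakNorm x₀ s₁ (fun j => w j * σ j / τ j) x' x'') := by
          gcongr
          exact iInf₂_le τ hτ
      _ ≤ C * (eLpNorm τ (conjIdx q₂ s₂) Measure.count *
            (eLpNorm w r Measure.count * weakNorm x₀ s₂ (fun j => σ j / τ j) x' x'')) := by
          gcongr
          exact aux_mono τ hc0 hidx
      _ = _ := by ring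
  haveI : Nonempty {τ : Fin m → ℝ // ∀ j, τ j ≠ 0} := ⟨⟨fun _ => 1, by simp⟩⟩
  unfold mixedNorm
  rw [iInf_subtype', ENNReal.mul_iInf (fun h => absurd h hC)]
  exact le_iInf key

/-- general inclusion theorem for Lipschitz `(p,m^L(s;q))`-summing maps. -/
theorem stmt9 {X Y : Type*} [MetricSpace X] [MetricSpace Y] (x₀ : X)
    (p₁ p₂ q₁ q₂ s₁ s₂ : ℝ≥0∞)
    (hp₁ : 0 < p₁) (hp : p₁ ≤ p₂) (hq₁ : 0 < q₁) (hq : q₁ ≤ q₂)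
    (hs₁ : 0 < s₁) (hs : s₁ ≤ s₂)
    (hq₁s₁ : q₁ ≤ s₁) (hq₂s₂ : q₂ ≤ s₂) (hq₁p₁ : q₁ ≤ p₁) (hq₂p₂ : q₂ ≤ p₂)
    (h1 : 1 / q₁ - 1 / q₂ ≤ 1 / s₁ - 1 / s₂) (h2 : 1 / s₁ - 1 / s₂ ≤ 1 / p₁ - 1 / p₂)
    (T : X → Y) (K : ℝ≥0) (hT : LipschitzWith K T)
    (hsum : LipPMixed x₀ p₁ s₁ q₁ T) :
    LipPMixed x₀ p₂ s₂ q₂ T ∧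
    lipPMixedNorm x₀ p₂ s₂ q₂ T ≤ lipPMixedNorm x₀ p₁ s₁ q₁ T := by
  obtain ⟨C, hC⟩ := hsum
  refine ⟨⟨C, fun m σ x' x'' => aux_main x₀ p₁ p₂ q₁ q₂ s₁ s₂ hp₁ hp hq₁ hq hs₁ hs hq₁s₁ hq₂s₂
    h1 h2 T C ENNReal.coe_ne_top hC m σ x' x''⟩, ?_⟩
  refine le_sInf fun D hD => ?_
  by_cases h : D = ∞
  · rw [h]; exact le_top
  · exact sInf_le fun m σ x' x'' => aux_main x₀ p₁ p₂ q₁ q₂ s₁ s₂ hp₁ hp hq₁ hq hs₁ hs hq₁s₁ hq₂s₂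
      h1 h2 T D h hD m σ x' x''
end
end

section
/- Let X and Y be pointed metric spaces. Suppose 1 ≤ s₂ ≤ s₁ ≤ ∞, 0 < p_j ≤ s_j for j = 1,2, 0 < p₁ ≤ p₂, 0 < r₁ ≤ r₂, r_j ≤ p_j for j = 1,2, and 1/r₁ − 1/r₂ ≤ 1/p₁ − 1/p₂. Then every Lipschitz (m^L(s₁;p₁),r₁)-summing map S : X → Y is Lipschitz (m^L(s₂;p₂),r₂)-summing and π^L_{(m^L(s₂;p₂),r₂)}(S) ≤ π^L_{(m^L(s₁;p₁),r₁)}(S). -/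
open MeasureTheory ENNReal NNReal

noncomputable section

lemma aux_tri (p q s : ℝ≥0∞) (hpq : p ≤ q) (hqs : q ≤ s) :
    (conjIdx p q)⁻¹ + (conjIdx q s)⁻¹ = (conjIdx p s)⁻¹ := by
  simp only [conjIdx, inv_inv, one_div]
  exact tsub_add_tsub_cancel (ENNReal.inv_le_inv.2 hpq) (ENNReal.inv_le_inv.2 hqs)

lemma aux_tri' (p s : ℝ≥0∞) (h : p ≤ s) : ENNReal.HolderTriple (conjIdx p s) s p := by
  constructor
  simp only [conjIdx, inv_inv, one_div]
  exact tsub_add_cancel_of_le (ENNReal.inv_le_inv.2 h)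

lemma conj_ne_zero (p s : ℝ≥0∞) (h : 0 < p) : conjIdx p s ≠ 0 := by
  simp only [conjIdx, one_div, ne_eq, ENNReal.inv_eq_zero]
  exact ne_top_of_le_ne_top (by simpa using h.ne') tsub_le_self

lemma conj_ne_top (p s : ℝ≥0∞) (h : p < s) : conjIdx p s ≠ ⊤ := by
  simp only [conjIdx, one_div, ne_eq, ENNReal.inv_eq_top]
  exact (tsub_pos_of_lt (ENNReal.inv_lt_inv.2 h)).ne'

lemma holder {m : ℕ} (p q r : ℝ≥0∞) (h : ENNReal.HolderTriple p q r) (f g k : Fin m → ℝ)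
    (hk : ∀ j, |k j| ≤ |f j| * |g j|) :
    eLpNorm k r Measure.count ≤ eLpNorm f p Measure.count * eLpNorm g q Measure.count := by
  refine le_trans (eLpNorm_mono (g := f • g) fun j => ?_)
    (eLpNorm_smul_le_mul_eLpNorm (.of_discrete) (.of_discrete))
  simpa [Real.norm_eq_abs, abs_mul] using hk j

lemma powNeq {m : ℕ} (a q : ℝ≥0∞) (c : ℝ) (hc : 0 < c)
    (h : q⁻¹ = ENNReal.ofReal c * a⁻¹) (τ : Fin m → ℝ) :
    eLpNorm (fun j => |τ j| ^ c) q Measure.count = eLpNorm τ a Measure.count ^ c := by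
  have := eLpNorm_norm_rpow (p := q) (μ := Measure.count) τ hc
  simp only [Real.norm_eq_abs] at this
  rw [this]
  have hq : q * ENNReal.ofReal c = a := by
    rw [← inv_inv q, h]
    have h0 : ENNReal.ofReal c ≠ 0 := by simpa using hc
    rw [ENNReal.mul_inv (Or.inl h0) (Or.inl ENNReal.ofReal_ne_top), inv_inv, mul_comm, ← mul_assoc,
      ENNReal.mul_inv_cancel h0 ENNReal.ofReal_ne_top, one_mul]
  rw [hq]

lemma powN {m : ℕ} (a q : ℝ≥0∞) (c : ℝ) (ha : a ≠ 0) (hc : 0 ≤ c)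
    (h : q⁻¹ = ENNReal.ofReal c * a⁻¹) (τ : Fin m → ℝ) :
    eLpNorm (fun j => |τ j| ^ c) q Measure.count ≤ eLpNorm τ a Measure.count ^ c := by
  rcases hc.eq_or_lt with rfl | hc
  · have : q = ⊤ := by simpa using h
    subst this
    simp only [Real.rpow_zero, eLpNorm_exponent_top, ENNReal.rpow_zero]
    rw [eLpNormEssSup_count]
    simp
  · exact (powNeq a q c hc h τ).le

lemma interp {m : ℕ} (s s0 s1 : ℝ≥0∞) (η : ℝ) (h0 : 0 ≤ η) (h1 : η ≤ 1) (hs0 : s0 ≠ 0) (hs1 : s1 ≠ 0)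
    (h : s⁻¹ = ENNReal.ofReal (1 - η) * s0⁻¹ + ENNReal.ofReal η * s1⁻¹) (A B R : Fin m → ℝ)
    (hR : ∀ j, |R j| ≤ |A j| ^ (1 - η) * |B j| ^ η) :
    eLpNorm R s Measure.count ≤
      eLpNorm A s0 Measure.count ^ (1 - η) * eLpNorm B s1 Measure.count ^ η := by
  refine le_trans (holder (ENNReal.ofReal (1 - η) * s0⁻¹)⁻¹ (ENNReal.ofReal η * s1⁻¹)⁻¹ s
    ⟨by simp [h]⟩ (fun j => |A j| ^ (1 - η)) (fun j => |B j| ^ η) R ?_) ?_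
  · intro j
    refine (hR j).trans_eq ?_
    rw [abs_of_nonneg (a := |A j| ^ (1 - η)) (by positivity),
      abs_of_nonneg (a := |B j| ^ η) (by positivity)]
  · exact mul_le_mul' (powN _ _ _ hs0 (by linarith) (by simp) _) (powN _ _ _ hs1 h0 (by simp) _)

lemma expMono {m : ℕ} (v t : ℝ≥0∞) (hv0 : v ≠ 0) (hvt : v ≤ t) (l : Fin m → ℝ) :
    eLpNorm l t Measure.count ≤ eLpNorm l v Measure.count := by
  have hinf : eLpNorm l ⊤ Measure.count ≤ eLpNorm l v Measure.count := by
    rw [eLpNorm_exponent_top, eLpNormEssSup_count]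
    exact iSup_le fun i => enorm_le_eLpNorm_count l i hv0
  rcases eq_or_ne t ⊤ with rfl | ht
  · exact hinf
  have hv : v ≠ ⊤ := ne_top_of_le_ne_top ht hvt
  have ht0 : t ≠ 0 := fun h => hv0 (by simpa [h] using hvt)
  have htp := ENNReal.toReal_pos ht0 ht
  have hvp := ENNReal.toReal_pos hv0 hv
  have hle := ENNReal.toReal_mono ht hvt
  have h1 : v.toReal / t.toReal ≤ 1 := (div_le_one htp).2 hle
  have h0 : 0 ≤ v.toReal / t.toReal := by positivity
  refine (interp t ⊤ v (v.toReal / t.toReal) h0 h1 (by simp) hv0 ?_ l l l ?_).trans ?_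
  · rw [ENNReal.ofReal_div_of_pos htp, ENNReal.ofReal_toReal hv, ENNReal.ofReal_toReal ht]
    simp only [ENNReal.inv_top, mul_zero, zero_add]
    rw [div_eq_mul_inv, mul_right_comm, ENNReal.mul_inv_cancel hv0 hv, one_mul]
  · intro j
    rw [← Real.rpow_add_of_nonneg (abs_nonneg _) (by linarith) h0]
    simp
  · calc _ ≤ eLpNorm l v Measure.count ^ (1 - v.toReal / t.toReal) *
        eLpNorm l v Measure.count ^ (v.toReal / t.toReal) :=
          mul_le_mul' (ENNReal.rpow_le_rpow hinf (by linarith)) le_rfl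
      _ = _ := by
        rw [← ENNReal.rpow_add_of_nonneg _ _ (by linarith) h0]
        simp

section
variable {X : Type*} [MetricSpace X] (x₀ : X)

lemma weak_le {m : ℕ} {f : X → ℝ} (hf : f ∈ dualBall X x₀) (p : ℝ≥0∞) (σ : Fin m → ℝ)
    (x' x'' : Fin m → X) :
    eLpNorm (fun j => σ j * (f (x' j) - f (x'' j))) p Measure.count ≤ weakNorm x₀ p σ x' x'' :=
  le_iSup₂_of_le (f := fun f (_ : f ∈ dualBall X x₀) =>
    eLpNorm (fun j => σ j * (f (x' j) - f (x'' j))) p Measure.count) f hf le_rfl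

lemma weak_ne_top {m : ℕ} (p : ℝ≥0∞) (σ : Fin m → ℝ) (x' x'' : Fin m → X) :
    weakNorm x₀ p σ x' x'' ≠ ⊤ := by
  refine ne_top_of_le_ne_top (b := strongNorm p σ x' x'')
    (eLpNorm_count_lt_top_of_lt fun i => enorm_lt_top).ne ?_
  refine iSup₂_le fun f hf => eLpNorm_mono fun j => ?_
  have := hf.1.dist_le_mul (x' j) (x'' j)
  simp only [NNReal.coe_one, one_mul, Real.dist_eq] at this
  simp only [Real.norm_eq_abs, abs_mul, abs_dist]
  gcongr

lemma weak_holder {m : ℕ} (u s r : ℝ≥0∞) (h : ENNReal.HolderTriple u s r) (l σ ρ : Fin m → ℝ)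
    (x' x'' : Fin m → X) (hρ : ∀ j, |ρ j| ≤ |l j| * |σ j|) :
    weakNorm x₀ r ρ x' x'' ≤ eLpNorm l u Measure.count * weakNorm x₀ s σ x' x'' := by
  refine iSup₂_le fun f hf => ?_
  refine (holder u s r h l (fun j => σ j * (f (x' j) - f (x'' j))) _ fun j => ?_).trans
    (mul_le_mul' le_rfl (weak_le x₀ hf _ _ _ _))
  rw [abs_mul, abs_mul, ← mul_assoc]
  exact mul_le_mul_of_nonneg_right (hρ j) (abs_nonneg _)

lemma weak_interp {m : ℕ} (s : ℝ≥0∞) (hs : s ≠ 0) (η : ℝ) (h0 : 0 ≤ η) (h1 : η ≤ 1)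
    (A B R : Fin m → ℝ) (x' x'' : Fin m → X)
    (hR : ∀ j, |R j| ≤ |A j| ^ (1 - η) * |B j| ^ η) :
    weakNorm x₀ s R x' x'' ≤
      weakNorm x₀ s A x' x'' ^ (1 - η) * weakNorm x₀ s B x' x'' ^ η := by
  refine iSup₂_le fun f hf => ?_
  refine (interp s s s η h0 h1 hs hs ?_ (fun j => A j * (f (x' j) - f (x'' j)))
    (fun j => B j * (f (x' j) - f (x'' j))) _ fun j => ?_).trans
    (mul_le_mul' (ENNReal.rpow_le_rpow (weak_le x₀ hf _ _ _ _) (by linarith))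
      (ENNReal.rpow_le_rpow (weak_le x₀ hf _ _ _ _) h0))
  · rw [← add_mul, ← ENNReal.ofReal_add (by linarith) h0]
    simp
  · rw [abs_mul, abs_mul, abs_mul, Real.mul_rpow (abs_nonneg _) (abs_nonneg _),
      Real.mul_rpow (abs_nonneg _) (abs_nonneg _), mul_mul_mul_comm,
      ← Real.rpow_add_of_nonneg (abs_nonneg _) (by linarith) h0]
    simp only [sub_add_cancel, Real.rpow_one]
    exact mul_le_mul_of_nonneg_right (hR j) (abs_nonneg _)

lemma mixed_le_s10 {m : ℕ} (s q : ℝ≥0∞) (σ τ : Fin m → ℝ) (x' x'' : Fin m → X) (h : ∀ j, τ j ≠ 0) :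
    mixedNorm x₀ s q σ x' x'' ≤
      eLpNorm τ (conjIdx q s) Measure.count * weakNorm x₀ s (fun j => σ j / τ j) x' x'' :=
  iInf₂_le (f := fun (τ : Fin m → ℝ) (_ : ∀ j, τ j ≠ 0) =>
    eLpNorm τ (conjIdx q s) Measure.count * weakNorm x₀ s (fun j => σ j / τ j) x' x'') τ h

lemma mixed_ne_top {m : ℕ} (s q : ℝ≥0∞) (σ : Fin m → ℝ) (x' x'' : Fin m → X) :
    mixedNorm x₀ s q σ x' x'' ≠ ⊤ :=
  ne_top_of_le_ne_top (ENNReal.mul_ne_top (eLpNorm_count_lt_top_of_lt fun i => by simp).ne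
    (weak_ne_top x₀ _ _ _ _)) (mixed_le_s10 x₀ s q σ (fun _ => 1) x' x'' (by simp))

lemma mixed_lt {m : ℕ} (s q : ℝ≥0∞) (σ : Fin m → ℝ) (x' x'' : Fin m → X) (y : ℝ≥0∞)
    (h : mixedNorm x₀ s q σ x' x'' < y) : ∃ τ : Fin m → ℝ, (∀ j, τ j ≠ 0) ∧
      eLpNorm τ (conjIdx q s) Measure.count * weakNorm x₀ s (fun j => σ j / τ j) x' x'' < y := by
  unfold mixedNorm at h
  simp only [iInf_lt_iff] at h
  obtain ⟨τ, h1, h2⟩ := h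
  exact ⟨τ, h1, h2⟩

lemma le_mixed {m : ℕ} (s q : ℝ≥0∞) (hqs : q ≤ s) {f : X → ℝ} (hf : f ∈ dualBall X x₀)
    (σ : Fin m → ℝ) (x' x'' : Fin m → X) :
    eLpNorm (fun j => σ j * (f (x' j) - f (x'' j))) q Measure.count ≤
      mixedNorm x₀ s q σ x' x'' := by
  refine le_iInf₂ fun τ hτ => ?_
  refine (holder _ _ _ (aux_tri' q s hqs) τ
    (fun j => σ j / τ j * (f (x' j) - f (x'' j))) _ fun j => ?_).trans
    (mul_le_mul' le_rfl (weak_le x₀ hf _ _ _ _))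
  rw [← abs_mul]
  apply le_of_eq
  congr 1
  have := hτ j
  field_simp

lemma mixed_mono {m : ℕ} (s₁ s₂ p : ℝ≥0∞) (hp : 0 < p) (hps : p ≤ s₂) (hs : s₂ ≤ s₁)
    (σ : Fin m → ℝ) (x' x'' : Fin m → X) :
    mixedNorm x₀ s₂ p σ x' x'' ≤ mixedNorm x₀ s₁ p σ x' x'' := by
  rcases hs.eq_or_lt with rfl | hlt
  · rfl
  refine le_iInf₂ fun τ hτ => ?_
  have htri := aux_tri p s₂ s₁ hps hs
  have ha0 := conj_ne_zero p s₁ hp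
  have hat := conj_ne_top p s₁ (hps.trans_lt hlt)
  have hb0 := conj_ne_zero p s₂ hp
  have hu0 := conj_ne_zero s₂ s₁ (hp.trans_le hps)
  set a := conjIdx p s₁
  set b := conjIdx p s₂
  set u := conjIdx s₂ s₁ with hu
  have hib : b⁻¹ ≠ ⊤ := by simpa using hb0
  have hiu : u⁻¹ ≠ ⊤ := by simpa using hu0
  have hia : a⁻¹ ≠ ⊤ := by simpa using ha0
  have hia0 : a⁻¹ ≠ 0 := by simpa using hat
  have hpos := ENNReal.toReal_pos hia0 hia
  have hsum : b⁻¹.toReal + u⁻¹.toReal = a⁻¹.toReal := by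
    rw [← ENNReal.toReal_add hib hiu, htri]
  have key : ∀ c : ℝ≥0∞, c ≠ ⊤ → c = ENNReal.ofReal (c.toReal / a⁻¹.toReal) * a⁻¹ := by
    intro c hc
    rw [ENNReal.ofReal_div_of_pos hpos, ENNReal.ofReal_toReal hc, ENNReal.ofReal_toReal hia,
      ENNReal.div_mul_cancel hia0 hia]
  have hsum1 : b⁻¹.toReal / a⁻¹.toReal + u⁻¹.toReal / a⁻¹.toReal = 1 := by
    rw [← add_div, hsum, div_self hpos.ne']
  have hα : 0 ≤ b⁻¹.toReal / a⁻¹.toReal := by positivity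
  have hβ : 0 ≤ u⁻¹.toReal / a⁻¹.toReal := by positivity
  have kb := key _ hib
  have ku := key _ hiu
  generalize b⁻¹.toReal / a⁻¹.toReal = α at *
  generalize u⁻¹.toReal / a⁻¹.toReal = β at *
  refine (mixed_le_s10 x₀ s₂ p σ (fun j => |τ j| ^ α) x' x'' fun j =>
    (Real.rpow_pos_of_pos (abs_pos.2 (hτ j)) _).ne').trans ?_
  calc _ ≤ eLpNorm τ a Measure.count ^ α * (eLpNorm τ a Measure.count ^ β *
        weakNorm x₀ s₁ (fun j => σ j / τ j) x' x'') := by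
        refine mul_le_mul' (powN a b α ha0 hα kb τ) ?_
        refine (weak_holder x₀ u s₁ s₂ (aux_tri' _ _ hs) (fun j => |τ j| ^ β)
          (fun j => σ j / τ j) _ x' x'' fun j => ?_).trans
            (mul_le_mul' (powN a u β ha0 hβ ku τ) le_rfl)
        have hp := abs_pos.2 (hτ j)
        rw [abs_div, abs_div, abs_of_nonneg (a := |τ j| ^ α) (by positivity),
          abs_of_nonneg (a := |τ j| ^ β) (by positivity)]
        have : |τ j| = |τ j| ^ α * |τ j| ^ β := by
          rw [← Real.rpow_add hp, hsum1, Real.rpow_one]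
        apply le_of_eq
        rw [mul_div_assoc', div_eq_div_iff (by positivity) hp.ne']
        conv_lhs => rw [this]
        ring
    _ = _ := by
        rw [← mul_assoc, ← ENNReal.rpow_add_of_nonneg _ _ hα hβ, hsum1, ENNReal.rpow_one]

end

lemma lim_le_s10 (M m k : ℝ≥0∞) (η : ℝ) (hk : k ≠ ⊤) (hm : m ≠ ⊤) (h : ∀ x, m < x → M ≤ x ^ η * k) :
    M ≤ m ^ η * k := by
  have hne : (nhdsWithin m (Set.Ioi m)).NeBot := by
    exact nhdsGT_neBot_of_exists_gt ⟨⊤, hm.lt_top⟩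
  have hc : Filter.Tendsto (fun x : ℝ≥0∞ => x ^ η * k) (nhdsWithin m (Set.Ioi m))
      (nhds (m ^ η * k)) :=
    (ENNReal.Tendsto.mul_const (ENNReal.continuous_rpow_const.tendsto m) (Or.inr hk)).mono_left
      nhdsWithin_le_nhds
  exact ge_of_tendsto hc (by filter_upwards [self_mem_nhdsWithin] with x hx using h x hx)

lemma fin_le (M Q : ℝ≥0∞) (η : ℝ) (hη : 0 < η) (hη1 : η < 1) (hM : M ≠ ⊤)
    (h : M ≤ M ^ (1 - η) * Q ^ η) : M ≤ Q := by
  rcases eq_or_ne M 0 with rfl | h0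
  · simp
  have e : M = M ^ (1 - η) * M ^ η := by
    rw [← ENNReal.rpow_add _ _ h0 hM]; simp
  have h' : M ^ (1 - η) * M ^ η ≤ M ^ (1 - η) * Q ^ η := e ▸ h
  rw [ENNReal.mul_le_mul_iff_right] at h'
  · exact (ENNReal.rpow_le_rpow_iff hη).1 h'
  · simp [ENNReal.rpow_eq_zero_iff, h0, hM]
  · exact ENNReal.rpow_ne_top_of_nonneg (by linarith) hM

lemma conv_holder {m : ℕ} (p s : ℝ≥0∞) (hp : 0 < p) (hps : p < s) (g : Fin m → ℝ)
    (hg : eLpNorm g s Measure.count ≠ 0) :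
    ∃ l : Fin m → ℝ, eLpNorm l (conjIdx p s) Measure.count ≠ 0 ∧
      eLpNorm g s Measure.count * eLpNorm l (conjIdx p s) Measure.count ≤
        eLpNorm (fun j => l j * g j) p Measure.count := by
  rcases eq_or_ne s ⊤ with rfl | hst
  · have hcj : conjIdx p ⊤ = p := by simp [conjIdx]
    rw [hcj]
    have hne : Nonempty (Fin m) := by
      by_contra hcon
      rw [not_nonempty_iff] at hcon
      apply hg
      rw [eLpNorm_exponent_top, eLpNormEssSup_count]
      simp
    obtain ⟨j₀, hj⟩ := Finite.exists_max (fun j => ‖g j‖ₑ)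
    refine ⟨Pi.single j₀ 1, ?_, ?_⟩
    · have := enorm_le_eLpNorm_count (Pi.single j₀ (1 : ℝ) : Fin m → ℝ) j₀ hp.ne'
      intro h0
      rw [h0] at this
      simp at this
    · have e : (fun j => (Pi.single j₀ (1 : ℝ) : Fin m → ℝ) j * g j) =
          g j₀ • (Pi.single j₀ (1 : ℝ) : Fin m → ℝ) := by
        funext j
        by_cases h : j = j₀
        · subst h; simp
        · simp [h]
      rw [e, eLpNorm_const_smul]
      refine mul_le_mul' ?_ le_rfl
      rw [eLpNorm_exponent_top, eLpNormEssSup_count]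
      exact iSup_le hj
  · have hv0 := conj_ne_zero p s hp
    have hvt := conj_ne_top p s hps
    have htri := (aux_tri' p s hps.le).inv_add_inv_eq_inv
    have hs0 : s ≠ 0 := (hp.trans hps).ne'
    have ivt : (conjIdx p s)⁻¹ ≠ ⊤ := by simpa using hv0
    have iv0 : (conjIdx p s)⁻¹ ≠ 0 := by simpa using hvt
    have ist : s⁻¹ ≠ ⊤ := by simpa using hs0
    have is0 : s⁻¹ ≠ 0 := by simpa using hst
    have Pv := ENNReal.toReal_pos iv0 ivt
    have Ps := ENNReal.toReal_pos is0 ist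
    have kv : (conjIdx p s)⁻¹ =
        ENNReal.ofReal ((conjIdx p s)⁻¹.toReal / s⁻¹.toReal) * s⁻¹ := by
      rw [ENNReal.ofReal_div_of_pos Ps, ENNReal.ofReal_toReal ivt, ENNReal.ofReal_toReal ist,
        ENNReal.div_mul_cancel is0 ist]
    obtain ⟨c, hc⟩ : ∃ c, c = (conjIdx p s)⁻¹.toReal / s⁻¹.toReal := ⟨_, rfl⟩
    rw [← hc] at kv
    have hc0 : 0 < c := by rw [hc]; positivity
    have kp : p⁻¹ = ENNReal.ofReal (1 + c) * s⁻¹ := by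
      rw [ENNReal.ofReal_add zero_le_one hc0.le, add_mul, ← kv, ← htri, add_comm]
      simp
    have hgt : eLpNorm g s Measure.count ≠ ⊤ := (eLpNorm_count_lt_top_of_lt fun i => by simp).ne
    have e2 := powNeq s p (1 + c) (by linarith) kp g
    refine ⟨fun j => |g j| ^ c, ?_, ?_⟩
    · rw [powNeq s _ c hc0 kv g]
      simp [ENNReal.rpow_eq_zero_iff, hg, hgt]
    · rw [powNeq s _ c hc0 kv g]
      calc _ = eLpNorm g s Measure.count ^ (1 + c) := by
            rw [ENNReal.rpow_add _ _ hg hgt, ENNReal.rpow_one]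
        _ ≤ _ := by
            rw [← e2]
            refine eLpNorm_mono fun j => le_of_eq ?_
            rw [Real.norm_eq_abs, Real.norm_eq_abs, abs_mul, abs_of_nonneg (by positivity),
              abs_of_nonneg (a := |g j| ^ c) (by positivity),
              Real.rpow_add_of_nonneg (abs_nonneg _) zero_le_one hc0.le, Real.rpow_one, mul_comm]

lemma main_case {X : Type*} [MetricSpace X] (x₀ : X) (p₁ p₂ s : ℝ≥0∞) (hp₁ : 0 < p₁)
    (h12 : p₁ < p₂) (h2s : p₂ ≤ s) {m : ℕ} (σ : Fin m → ℝ) (x' x'' : Fin m → X) (Q : ℝ≥0∞)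
    (hQ : Q ≠ ⊤)
    (H : ∀ l : Fin m → ℝ, mixedNorm x₀ s p₁ (fun j => l j * σ j) x' x'' ≤
      Q * eLpNorm l (conjIdx p₁ p₂) Measure.count) :
    mixedNorm x₀ s p₂ σ x' x'' ≤ Q := by
  have hs0 : s ≠ 0 := (hp₁.trans (h12.trans_le h2s)).ne'
  rcases h2s.eq_or_lt with rfl | hlt
  · have : mixedNorm x₀ p₂ p₂ σ x' x'' ≤ weakNorm x₀ p₂ σ x' x'' := by
      refine (mixed_le_s10 x₀ p₂ p₂ σ (fun _ => 1) x' x'' (by simp)).trans ?_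
      have : conjIdx p₂ p₂ = ⊤ := by simp [conjIdx]
      rw [this, eLpNorm_exponent_top, eLpNormEssSup_count]
      simp only [div_one]
      exact mul_le_of_le_one_left' (by simp)
    refine this.trans (iSup₂_le fun f hf => ?_)
    by_cases hg : eLpNorm (fun j => σ j * (f (x' j) - f (x'' j))) p₂ Measure.count = 0
    · simp [hg]
    obtain ⟨l, hl0, hl⟩ := conv_holder p₁ p₂ hp₁ h12 _ hg
    have h3 := le_mixed x₀ p₂ p₁ h12.le hf (fun j => l j * σ j) x' x''
    simp only [mul_assoc] at h3
    have h4 := hl.trans (h3.trans (H l))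
    rwa [ENNReal.mul_le_mul_iff_left hl0 (eLpNorm_count_lt_top_of_lt fun i => by simp).ne] at h4
  have htri := aux_tri p₁ p₂ s h12.le h2s
  have hp₂ := hp₁.trans h12
  have ha10 := conj_ne_zero p₁ s hp₁
  have ha20 := conj_ne_zero p₂ s hp₂
  have hv0 := conj_ne_zero p₁ p₂ hp₁
  have ha1t := conj_ne_top p₁ s (h12.trans hlt)
  have ha2t := conj_ne_top p₂ s hlt
  have hvt := conj_ne_top p₁ p₂ h12
  set M := mixedNorm x₀ s p₂ σ x' x'' with hM
  have hMt : M ≠ ⊤ := mixed_ne_top x₀ s p₂ σ x' x''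
  have i1t : (conjIdx p₁ s)⁻¹ ≠ ⊤ := by simpa using ha10
  have i2t : (conjIdx p₂ s)⁻¹ ≠ ⊤ := by simpa using ha20
  have ivt : (conjIdx p₁ p₂)⁻¹ ≠ ⊤ := by simpa using hv0
  have i10 : (conjIdx p₁ s)⁻¹ ≠ 0 := by simpa using ha1t
  have i20 : (conjIdx p₂ s)⁻¹ ≠ 0 := by simpa using ha2t
  have iv0 : (conjIdx p₁ p₂)⁻¹ ≠ 0 := by simpa using hvt
  have P1 := ENNReal.toReal_pos i10 i1t
  have P2 := ENNReal.toReal_pos i20 i2t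
  have Pv := ENNReal.toReal_pos iv0 ivt
  have hsum : (conjIdx p₁ p₂)⁻¹.toReal + (conjIdx p₂ s)⁻¹.toReal = (conjIdx p₁ s)⁻¹.toReal := by
    rw [← ENNReal.toReal_add ivt i2t, htri]
  have key : ∀ c a : ℝ≥0∞, c ≠ ⊤ → a ≠ ⊤ → 0 < a.toReal →
      c = ENNReal.ofReal (c.toReal / a.toReal) * a := by
    intro c a hc ha hpos
    rw [ENNReal.ofReal_div_of_pos hpos, ENNReal.ofReal_toReal hc, ENNReal.ofReal_toReal ha,
      ENNReal.div_mul_cancel (fun h => by simp [h] at hpos) ha]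
  have k2 := key _ _ i2t i1t P1
  have kv := key _ _ ivt i2t P2
  obtain ⟨η, hη⟩ : ∃ η, η = (conjIdx p₂ s)⁻¹.toReal / (conjIdx p₁ s)⁻¹.toReal := ⟨_, rfl⟩
  obtain ⟨c, hc⟩ : ∃ c, c = (conjIdx p₁ p₂)⁻¹.toReal / (conjIdx p₂ s)⁻¹.toReal := ⟨_, rfl⟩
  rw [← hη] at k2
  rw [← hc] at kv
  have hη0 : 0 < η := by rw [hη]; positivity
  have hc0 : 0 < c := by rw [hc]; positivity
  have hcη : c * η = 1 - η := by
    rw [hc, hη, ← hsum]; field_simp; ring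
  have hη1 : η < 1 := by nlinarith [mul_pos hc0 hη0]
  refine fin_le M Q η hη0 hη1 hMt ?_
  refine lim_le_s10 _ _ _ _ (ENNReal.rpow_ne_top_of_nonneg hη0.le hQ) hMt fun y hy => ?_
  obtain ⟨τs, hτs, hy'⟩ := mixed_lt x₀ s p₂ σ x' x'' y hy
  set W := weakNorm x₀ s (fun j => σ j / τs j) x' x'' with hW
  have hWt : W ≠ ⊤ := weak_ne_top x₀ _ _ _ _
  set l : Fin m → ℝ := fun j => |τs j| ^ c with hl
  set M1 := mixedNorm x₀ s p₁ (fun j => l j * σ j) x' x'' with hM1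
  have hM1t : M1 ≠ ⊤ := mixed_ne_top x₀ _ _ _ _ _
  have step : M ≤ M1 ^ η * W ^ (1 - η) := by
    refine lim_le_s10 _ _ _ _ (ENNReal.rpow_ne_top_of_nonneg (by linarith) hWt) hM1t fun z hz => ?_
    obtain ⟨t, ht, hz'⟩ := mixed_lt x₀ s p₁ (fun j => l j * σ j) x' x'' z hz
    refine (mixed_le_s10 x₀ s p₂ σ (fun j => |t j| ^ η) x' x'' fun j =>
      (Real.rpow_pos_of_pos (abs_pos.2 (ht j)) _).ne').trans ?_
    refine (mul_le_mul' (powN _ _ η ha10 hη0.le k2 t) (weak_interp x₀ s hs0 η hη0.le hη1.le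
      (fun j => σ j / τs j) (fun j => l j * σ j / t j) _ x' x'' fun j => ?_)).trans ?_
    · have htp := abs_pos.2 (ht j)
      have hsp := abs_pos.2 (hτs j)
      simp only [hl]
      rw [abs_div, abs_div, abs_div, abs_mul, abs_of_nonneg (a := |t j| ^ η) (by positivity),
        abs_of_nonneg (a := |τs j| ^ c) (by positivity),
        Real.div_rpow (by positivity) (by positivity), Real.div_rpow (by positivity) (by positivity),
        Real.mul_rpow (by positivity) (by positivity), ← Real.rpow_mul (by positivity), hcη]
      have e : |σ j| = |σ j| ^ (1 - η) * |σ j| ^ η := by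
        rw [← Real.rpow_add_of_nonneg (abs_nonneg _) (by linarith) hη0.le]; simp
      conv_lhs => rw [e]
      apply le_of_eq
      field_simp
    · rw [mul_comm (weakNorm x₀ s (fun j => σ j / τs j) x' x'' ^ (1 - η)), ← mul_assoc,
        ← ENNReal.mul_rpow_of_nonneg _ _ hη0.le]
      exact mul_le_mul' (ENNReal.rpow_le_rpow hz'.le hη0.le) le_rfl
  calc M ≤ M1 ^ η * W ^ (1 - η) := step
    _ ≤ (Q * eLpNorm τs (conjIdx p₂ s) Measure.count ^ c) ^ η * W ^ (1 - η) := by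
        refine mul_le_mul' (ENNReal.rpow_le_rpow ((H l).trans ?_) hη0.le) le_rfl
        exact mul_le_mul' le_rfl (powN _ _ c ha20 hc0.le kv τs)
    _ = (eLpNorm τs (conjIdx p₂ s) Measure.count * W) ^ (1 - η) * Q ^ η := by
        rw [ENNReal.mul_rpow_of_nonneg _ _ hη0.le, ← ENNReal.rpow_mul, hcη,
          ENNReal.mul_rpow_of_nonneg _ _ (by linarith : 0 ≤ 1 - η)]
        ring
    _ ≤ y ^ (1 - η) * Q ^ η :=
        mul_le_mul' (ENNReal.rpow_le_rpow hy'.le (by linarith)) le_rfl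

/-- general inclusion theorem for Lipschitz `(m^L(s;p),r)`-summing maps. -/
theorem stmt10 {X Y : Type*} [MetricSpace X] [MetricSpace Y] (x₀ : X) (y₀ : Y)
    (p₁ p₂ r₁ r₂ s₁ s₂ : ℝ≥0∞)
    (hs₂1 : 1 ≤ s₂) (hs : s₂ ≤ s₁)
    (hp₁ : 0 < p₁) (hp₁s₁ : p₁ ≤ s₁) (hp₂ : 0 < p₂) (hp₂s₂ : p₂ ≤ s₂) (hp : p₁ ≤ p₂)
    (hr₁ : 0 < r₁) (hr : r₁ ≤ r₂) (hr₁p₁ : r₁ ≤ p₁) (hr₂p₂ : r₂ ≤ p₂)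
    (h1 : 1 / r₁ - 1 / r₂ ≤ 1 / p₁ - 1 / p₂)
    (S : X → Y) (K : ℝ≥0) (hS : LipschitzWith K S)
    (hsum : LipMixedP x₀ y₀ s₁ p₁ r₁ S) :
    LipMixedP x₀ y₀ s₂ p₂ r₂ S ∧
    lipMixedPNorm x₀ y₀ s₂ p₂ r₂ S ≤ lipMixedPNorm x₀ y₀ s₁ p₁ r₁ S := by
  have main : ∀ C : ℝ≥0, (∀ (m : ℕ) (σ : Fin m → ℝ) (x' x'' : Fin m → X),
      mixedNorm y₀ s₁ p₁ σ (S ∘ x') (S ∘ x'') ≤ C * weakNorm x₀ r₁ σ x' x'') →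
      (∀ (m : ℕ) (σ : Fin m → ℝ) (x' x'' : Fin m → X),
      mixedNorm y₀ s₂ p₂ σ (S ∘ x') (S ∘ x'') ≤ C * weakNorm x₀ r₂ σ x' x'') := by
    intro C hC m σ x' x''
    have hC' := fun σ : Fin m → ℝ => (mixed_mono y₀ s₁ s₂ p₁ hp₁ (hp.trans hp₂s₂) hs σ
      (S ∘ x') (S ∘ x'')).trans (hC m σ x' x'')
    rcases hp.eq_or_lt with rfl | hlt
    · have : r₁ = r₂ := by
        refine le_antisymm hr ?_
        simp only [tsub_self, nonpos_iff_eq_zero, one_div, tsub_eq_zero_iff_le] at h1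
        exact ENNReal.inv_le_inv.1 h1
      subst this
      exact hC' σ
    · refine main_case y₀ p₁ p₂ s₂ hp₁ hlt hp₂s₂ σ _ _ _
        (ENNReal.mul_ne_top ENNReal.coe_ne_top (weak_ne_top x₀ _ _ _ _)) fun l => ?_
      refine (hC' _).trans ?_
      rw [mul_assoc]
      refine mul_le_mul' le_rfl ?_
      rw [mul_comm]
      refine (weak_holder x₀ _ r₂ r₁ (aux_tri' r₁ r₂ hr) l σ _ x' x''
        fun j => (abs_mul _ _).le).trans (mul_le_mul' ?_ le_rfl)
      exact expMono _ _ (conj_ne_zero _ _ hp₁) (ENNReal.inv_le_inv.2 h1) l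
  refine ⟨?_, ?_⟩
  · obtain ⟨C, hC⟩ := hsum
    exact ⟨C, main C hC⟩
  · refine le_sInf fun C hC => ?_
    rcases eq_or_ne C ⊤ with rfl | hCt
    · exact le_top
    lift C to ℝ≥0 using hCt
    exact sInf_le (main C hC)
end
end
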